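/- arXiv:2604.20774 — 2 statements merged into one kernel-verified Lean document; each statement's English description precedes it below -/
import Mathlib

section
/- Let d ≥ 2 and let α₁, …, α_n, β ∈ ℕ₀^d be multi-indices such that: (i) there exists Λ ∈ ℕ^d with ⟨α_j, Λ⟩ = ⟨β, Λ⟩ for all j = 1, …, n; and (ii) there exists ξ ∈ {0,1}^d with ⟨β, ξ⟩ ≢ ⟨α₁, ξ⟩ (mod 2) and ⟨α_j, ξ⟩ ≡ ⟨α₁, ξ⟩ (mod 2) for j = 2, …, n. Then there exists c > 0 such that for every skew-symmetric d×d real matrix Θ = [θ_{kl}] whose above-diagonal entries θ_{kl} (k < l) are irrational numbers in [0,1] such that 1 together with these entries are linearly independent over ℚ, and for every natural number N ≥ 2, there exist a complex Hilbert space H, unitary operators U₁, …, U_d on H satisfying U_k·U_l = e^{2πiθ_{kl}}·U_l·U_k for all k, l, a unit vector e₀ ∈ H with ⟨U^{α}·e₀, e₀⟩ = 0 for all α ∈ ℤ^d ∖ {0}, and a finitely supported family of complex coefficients (c_γ)_{γ ∈ ℤ^d} defining f := Σ_γ c_γ·U^{γ}, such that, with τ(T) := ⟨T·e₀, e₀⟩: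 Σ_{j=1}^{n} τ(|D^{α_j} f|) ≤ 1 and τ(|D^{β} f|) ≥ c·(log N)^{1/2}. -/
open scoped Real

noncomputable section

/-- A bundled complex Hilbert space. -/
structure HilbertSetup where
  H : Type
  [normed : NormedAddCommGroup H]
  [ips : InnerProductSpace ℂ H]
  [complete : CompleteSpace H]

attribute [instance] HilbertSetup.normed HilbertSetup.ips HilbertSetup.complete

variable {H : Type*} [NormedAddCommGroup H] [InnerProductSpace ℂ H] [CompleteSpace H]

/-- The vector state `τ(T) = ⟨T e₀, e₀⟩` (in Mathlib's convention `⟪e₀, T e₀⟫`). -/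
def vecState (e₀ : H) (T : H →L[ℂ] H) : ℂ :=
  @inner ℂ H _ e₀ (T e₀)

/-- The absolute value `|T| = (T^* T)^{1/2}` of a bounded operator. -/
def opAbs (T : H →L[ℂ] H) : H →L[ℂ] H :=
  CFC.sqrt (star T * T)

/-- The non-commutative `L¹` quantity `τ(|T|)`, a real number since `|T| ≥ 0`. -/
def l1Norm (e₀ : H) (T : H →L[ℂ] H) : ℝ :=
  (vecState e₀ (opAbs T)).re

/-- The ordered monomial `U^γ = U₁^{γ₁} U₂^{γ₂} ⋯ U_d^{γ_d}`. -/
def qMonoD {d : ℕ} (U : Fin d → unitary (H →L[ℂ] H)) (γ : Fin d → ℤ) : H →L[ℂ] H :=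
  (((List.ofFn fun k : Fin d => U k ^ γ k).prod : unitary (H →L[ℂ] H)) : H →L[ℂ] H)

/-- `D^α f` for `f = Σ_γ c_γ U^γ`: the coefficient `c_γ` is multiplied by
`∏_k (2πi γ_k)^{α_k}`. -/
def derivPolyD {d : ℕ} (U : Fin d → unitary (H →L[ℂ] H)) (c : (Fin d → ℤ) →₀ ℂ)
    (α : Fin d → ℕ) : H →L[ℂ] H :=
  ∑ γ ∈ c.support,
    ((∏ k : Fin d, (2 * (π : ℂ) * Complex.I * (γ k : ℂ)) ^ (α k)) * c γ) • qMonoD U γ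

open MeasureTheory Filter Topology

/-- A finite trigonometric sum in finitely many ordered variables, together with a natural scale for
each variable.  Only the highest variable occurring in a frequency contributes to its symbol. -/
structure WaveConfig where
  ι : Type
  κ : Type
  [finι : Fintype ι]
  [finκ : Fintype κ]
  rank : ι → ℕ
  rank_injective : Function.Injective rank
  scale : ι → ℕ
  one_le_scale : ∀ k, 1 ≤ scale k
  freq : κ → ι → ℤ
  top : κ → ι
  coef : κ → ℂ
  freq_top : ∀ s, freq s (top s) ≠ 0
  freq_above : ∀ s l, rank (top s) < rank l → freq s l = 0

attribute [instance] WaveConfig.finι WaveConfig.finκ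

/-- The normalised Haar measure on a finite-dimensional torus. -/
def torusMeasure (ι : Type) [Fintype ι] : Measure (ι → UnitAddCircle) :=
  Measure.pi fun _ => AddCircle.haarAddCircle

instance (ι : Type) [Fintype ι] : IsProbabilityMeasure (torusMeasure ι) := by
  unfold torusMeasure; infer_instance

lemma integrable_torusMeasure {ι : Type} [Fintype ι] {E : Type*} [NormedAddCommGroup E]
    {f : (ι → UnitAddCircle) → E} (hf : Continuous f) : Integrable f (torusMeasure ι) := by
  exact hf.integrable_of_hasCompactSupport (HasCompactSupport.of_compactSpace f)

lemma integrable_torusMeasure_prod {ι κ : Type} [Fintype ι] [Fintype κ] {E : Type*}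
    [NormedAddCommGroup E] {f : (ι → UnitAddCircle) × (κ → UnitAddCircle) → E}
    (hf : Continuous f) : Integrable f ((torusMeasure ι).prod (torusMeasure κ)) := by
  exact hf.integrable_of_hasCompactSupport (HasCompactSupport.of_compactSpace f)

lemma continuous_integral_torus {ι κ : Type} [Fintype ι] [Fintype κ]
    {f : (ι → UnitAddCircle) → (κ → UnitAddCircle) → ℝ}
    (hf : Continuous (fun p : (ι → UnitAddCircle) × (κ → UnitAddCircle) => f p.1 p.2)) :
    Continuous fun y => ∫ x, f x y ∂torusMeasure ι := by
  have h := continuous_parametric_integral_of_continuous (μ := torusMeasure ι)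
    (f := fun y x => f x y) (s := Set.univ)
    (by exact hf.comp continuous_swap) isCompact_univ
  simpa using h

lemma integral_torusMeasure_sum {ι κ : Type} [Fintype ι] [Fintype κ]
    {f : (ι ⊕ κ → UnitAddCircle) → ℝ} (hf : Continuous f) :
    ∫ z, f z ∂torusMeasure (ι ⊕ κ)
      = ∫ y, ∫ x, f (Sum.elim x y) ∂torusMeasure ι ∂torusMeasure κ := by
  have h := (measurePreserving_sumPiEquivProdPi_symm
    (X := fun _ : ι ⊕ κ => UnitAddCircle) (fun _ => AddCircle.haarAddCircle)).integral_comp'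
      (g := f)
  have hcont : Continuous fun p : (ι → UnitAddCircle) × (κ → UnitAddCircle) =>
      f (Sum.elim p.1 p.2) := by
    refine hf.comp (continuous_pi fun i => ?_)
    rcases i with i | i <;> simp <;> fun_prop
  have hint := integrable_torusMeasure_prod hcont
  unfold torusMeasure at *
  rw [← h]
  rw [← integral_prod_symm (fun p : (ι → UnitAddCircle) × (κ → UnitAddCircle) =>
      f (Sum.elim p.1 p.2)) hint]
  refine integral_congr_ae (Filter.Eventually.of_forall fun p => ?_)
  simp only
  congr 1

lemma integral_mFourier {ι : Type} [Fintype ι] (m : ι → ℤ) :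
    ∫ x, UnitAddTorus.mFourier m x ∂torusMeasure ι = if m = 0 then 1 else 0 := by
  have h1 : ∀ n : ℤ, ∫ x : UnitAddCircle, fourier n x ∂AddCircle.haarAddCircle
      = if n = 0 then (1 : ℂ) else 0 := by
    intro n
    have := fourierCoeff_fourier n (T := 1)
    have h := congrFun this 0
    simp only [fourierCoeff, neg_zero, fourier_zero, one_smul] at h
    rw [h]
    simp [Pi.single_apply, eq_comm]
  unfold torusMeasure
  have := integral_fintype_prod_eq_prod
    (μ := fun _ : ι => (AddCircle.haarAddCircle : Measure UnitAddCircle))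
    (f := fun i (x : UnitAddCircle) => (fourier (m i) x : ℂ))
  simp only [UnitAddTorus.mFourier, ContinuousMap.coe_mk]
  rw [this]
  simp_rw [h1]
  rw [Finset.prod_ite_zero]
  simp [funext_iff]

namespace WaveConfig

/-- The factor by which the exponent `a = (degree, weight)` multiplies the `s`-th term. -/
def sym (X : WaveConfig) (a : ℕ × ℕ) (s : X.κ) : ℂ :=
  (2 * (π : ℂ) * Complex.I * (X.freq s (X.top s) : ℂ)) ^ a.1 * (X.scale (X.top s) : ℂ) ^ a.2

/-- The trigonometric polynomial obtained by applying the exponent `a`. -/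
def fn (X : WaveConfig) (a : ℕ × ℕ) (x : X.ι → UnitAddCircle) : ℂ :=
  ∑ s, X.coef s * X.sym a s * UnitAddTorus.mFourier (X.freq s) x

/-- The `L¹` norm of `X.fn a`. -/
def nrm (X : WaveConfig) (a : ℕ × ℕ) : ℝ := ∫ x, ‖X.fn a x‖ ∂torusMeasure X.ι

@[fun_prop]
lemma continuous_fn (X : WaveConfig) (a : ℕ × ℕ) : Continuous (X.fn a) := by
  unfold fn; fun_prop

lemma nrm_nonneg (X : WaveConfig) (a : ℕ × ℕ) : 0 ≤ X.nrm a :=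
  integral_nonneg fun _ => norm_nonneg _

lemma freq_ne_zero (X : WaveConfig) (s : X.κ) : X.freq s ≠ 0 := fun h =>
  X.freq_top s (by simp [h])

lemma integral_fn (X : WaveConfig) (a : ℕ × ℕ) : ∫ x, X.fn a x ∂torusMeasure X.ι = 0 := by
  unfold fn
  rw [integral_finsetSum _ fun s _ => integrable_torusMeasure (by fun_prop)]
  refine Finset.sum_eq_zero fun s _ => ?_
  rw [integral_const_mul, integral_mFourier, if_neg (X.freq_ne_zero s), mul_zero]

/-- Multiplication by a scalar. -/
def smul (c : ℂ) (X : WaveConfig) : WaveConfig where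
  ι := X.ι
  κ := X.κ
  rank := X.rank
  rank_injective := X.rank_injective
  scale := X.scale
  one_le_scale := X.one_le_scale
  freq := X.freq
  top := X.top
  coef := fun s => c * X.coef s
  freq_top := X.freq_top
  freq_above := X.freq_above

lemma fn_smul (c : ℂ) (X : WaveConfig) (a : ℕ × ℕ) (x : X.ι → UnitAddCircle) :
    (X.smul c).fn a x = c * X.fn a x := by
  unfold fn
  rw [Finset.mul_sum]
  refine Finset.sum_congr rfl fun s _ => ?_
  change c * X.coef s * X.sym a s * UnitAddTorus.mFourier (X.freq s) x = _
  ring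

lemma nrm_smul (c : ℂ) (X : WaveConfig) (a : ℕ × ℕ) : (X.smul c).nrm a = ‖c‖ * X.nrm a := by
  have h : (X.smul c).nrm a = ∫ x, ‖c‖ * ‖X.fn a x‖ ∂torusMeasure X.ι :=
    integral_congr_ae (Filter.Eventually.of_forall fun x => by
      simp only
      rw [fn_smul c X a x, norm_mul])
  rw [h, integral_const_mul, nrm]

lemma sym_ne_zero (X : WaveConfig) (a : ℕ × ℕ) (s : X.κ) : X.sym a s ≠ 0 := by
  have h1 := X.freq_top s
  have h2 : X.scale (X.top s) ≠ 0 := by have := X.one_le_scale (X.top s); omega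
  unfold sym
  refine mul_ne_zero (pow_ne_zero _ ?_) (pow_ne_zero _ (by exact_mod_cast h2))
  simp [Real.pi_ne_zero, h1]

/-- The composition of `X` with `Y`, in which the terms of `Y`, sitting in higher variables, are
modulated by `1 + X.fn v`. -/
def comp (v : ℕ × ℕ) (X Y : WaveConfig) : WaveConfig where
  ι := X.ι ⊕ Y.ι
  κ := X.κ ⊕ (Option X.κ × Y.κ)
  rank := Sum.elim X.rank fun l => Y.rank l + ∑ k, (X.rank k + 1)
  rank_injective := by
    have hM : ∀ k, X.rank k < ∑ k, (X.rank k + 1) := fun k =>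
      Nat.lt_of_succ_le (Finset.single_le_sum (f := fun k => X.rank k + 1)
        (fun _ _ => Nat.zero_le _) (Finset.mem_univ k))
    rintro (k | k) (l | l) h
    · exact congrArg _ (X.rank_injective h)
    · have := hM k
      simp only [Sum.elim_inl, Sum.elim_inr] at h
      omega
    · have := hM l
      simp only [Sum.elim_inl, Sum.elim_inr] at h
      omega
    · exact congrArg _ (Y.rank_injective (by simpa using h))
  scale := Sum.elim X.scale Y.scale
  one_le_scale := by
    rintro (k | k)
    exacts [X.one_le_scale k, Y.one_le_scale k]
  freq := Sum.elim (fun s => Sum.elim (X.freq s) 0)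
    fun p => Sum.elim (p.1.elim 0 X.freq) (Y.freq p.2)
  top := Sum.elim (fun s => Sum.inl (X.top s)) fun p => Sum.inr (Y.top p.2)
  coef := Sum.elim X.coef fun p => p.1.elim 1 (fun s => X.coef s * X.sym v s) * Y.coef p.2
  freq_top := by
    rintro (s | p)
    exacts [X.freq_top s, Y.freq_top p.2]
  freq_above := by
    have hM : ∀ k, X.rank k < ∑ k, (X.rank k + 1) := fun k =>
      Nat.lt_of_succ_le (Finset.single_le_sum (f := fun k => X.rank k + 1)
        (fun _ _ => Nat.zero_le _) (Finset.mem_univ k))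
    rintro (s | p) (l | l) h
    · exact X.freq_above s l h
    · rfl
    · have := hM l
      simp only [Sum.elim_inl, Sum.elim_inr] at h
      omega
    · exact Y.freq_above p.2 l (by simpa using h)

lemma mFourier_sum_elim {ι κ : Type} [Fintype ι] [Fintype κ] (m : ι → ℤ) (n : κ → ℤ)
    (x : ι → UnitAddCircle) (y : κ → UnitAddCircle) :
    UnitAddTorus.mFourier (Sum.elim m n) (Sum.elim x y)
      = UnitAddTorus.mFourier m x * UnitAddTorus.mFourier n y := by
  simp [UnitAddTorus.mFourier]

lemma fn_comp (v : ℕ × ℕ) (X Y : WaveConfig) (a : ℕ × ℕ) (x : X.ι → UnitAddCircle)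
    (y : Y.ι → UnitAddCircle) :
    (comp v X Y).fn a (Sum.elim x y) = X.fn a x + (1 + X.fn v x) * Y.fn a y := by
  have h : (comp v X Y).fn a (Sum.elim x y)
      = ∑ s : X.κ ⊕ (Option X.κ × Y.κ), (comp v X Y).coef s * (comp v X Y).sym a s *
        UnitAddTorus.mFourier ((comp v X Y).freq s) (Sum.elim x y) := rfl
  rw [h, Fintype.sum_sum_type, Fintype.sum_prod_type, Fintype.sum_option]
  have h0 : ∀ n : Y.ι → ℤ, UnitAddTorus.mFourier (Sum.elim (0 : X.ι → ℤ) n) (Sum.elim x y)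
      = UnitAddTorus.mFourier n y := fun n => by
    rw [mFourier_sum_elim, UnitAddTorus.mFourier_zero]; simp
  have h1 : ∀ n : X.ι → ℤ, UnitAddTorus.mFourier (Sum.elim n (0 : Y.ι → ℤ)) (Sum.elim x y)
      = UnitAddTorus.mFourier n x := fun n => by
    rw [mFourier_sum_elim, UnitAddTorus.mFourier_zero]; simp
  have e1 : ∀ s, (comp v X Y).coef (Sum.inl s) * (comp v X Y).sym a (Sum.inl s) *
        UnitAddTorus.mFourier ((comp v X Y).freq (Sum.inl s)) (Sum.elim x y)
      = X.coef s * X.sym a s * UnitAddTorus.mFourier (X.freq s) x := fun s => by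
    rw [← h1]; rfl
  have e2 : ∀ s, (comp v X Y).coef (Sum.inr (none, s)) * (comp v X Y).sym a (Sum.inr (none, s)) *
        UnitAddTorus.mFourier ((comp v X Y).freq (Sum.inr (none, s))) (Sum.elim x y)
      = Y.coef s * Y.sym a s * UnitAddTorus.mFourier (Y.freq s) y := fun s => by
    rw [← h0, ← one_mul (Y.coef s)]; rfl
  have e3 : ∀ r s, (comp v X Y).coef (Sum.inr (some r, s)) *
        (comp v X Y).sym a (Sum.inr (some r, s)) *
        UnitAddTorus.mFourier ((comp v X Y).freq (Sum.inr (some r, s))) (Sum.elim x y)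
      = (X.coef r * X.sym v r * UnitAddTorus.mFourier (X.freq r) x) *
        (Y.coef s * Y.sym a s * UnitAddTorus.mFourier (Y.freq s) y) := fun r s => by
    trans (X.coef r * X.sym v r * Y.coef s) * Y.sym a s *
      (UnitAddTorus.mFourier (X.freq r) x * UnitAddTorus.mFourier (Y.freq s) y)
    · rw [← mFourier_sum_elim]; rfl
    · ring
  simp_rw [e1, e2, e3, ← Finset.mul_sum, ← Finset.sum_mul]
  simp only [fn]
  ring

lemma integral_comp (v : ℕ × ℕ) (X Y : WaveConfig) (a : ℕ × ℕ) {F : ℂ → ℝ} (hF : Continuous F) :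
    ∫ z, F ((comp v X Y).fn a z) ∂torusMeasure (comp v X Y).ι
      = ∫ y, ∫ x, F (X.fn a x + (1 + X.fn v x) * Y.fn a y)
          ∂torusMeasure X.ι ∂torusMeasure Y.ι := by
  have h := integral_torusMeasure_sum (ι := X.ι) (κ := Y.ι)
    (f := fun z => F ((comp v X Y).fn a z)) (hF.comp (continuous_fn _ _))
  simp_rw [fn_comp] at h
  exact h

/-- The `L¹` norm of `1 + X.fn v`. -/
def one (X : WaveConfig) (v : ℕ × ℕ) : ℝ := ∫ x, ‖1 + X.fn v x‖ ∂torusMeasure X.ι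

lemma one_nonneg (X : WaveConfig) (v : ℕ × ℕ) : 0 ≤ X.one v :=
  integral_nonneg fun _ => norm_nonneg _

lemma nrm_le_one_add (X : WaveConfig) (v : ℕ × ℕ) : X.nrm v ≤ X.one v + 1 := by
  have h : ∫ x, (‖1 + X.fn v x‖ + 1) ∂torusMeasure X.ι = X.one v + 1 := by
    rw [integral_add (integrable_torusMeasure (by fun_prop)) (integrable_const _)]
    simp [one]
  rw [← h]
  refine integral_mono (integrable_torusMeasure (by fun_prop))
    (integrable_torusMeasure (by fun_prop)) fun x => ?_
  have := norm_sub_le (1 + X.fn v x) 1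
  simpa using this

lemma one_le (X : WaveConfig) (v : ℕ × ℕ) :
    X.one v ≤ 1 + (∫ x, ‖X.fn v x‖ ^ 2 ∂torusMeasure X.ι) / 2 := by
  have h : ∫ x, (1 + (X.fn v x).re + ‖X.fn v x‖ ^ 2 / 2) ∂torusMeasure X.ι
      = 1 + (∫ x, ‖X.fn v x‖ ^ 2 ∂torusMeasure X.ι) / 2 := by
    have hre : ∫ x, (X.fn v x).re ∂torusMeasure X.ι = 0 := by
      have := integral_re (𝕜 := ℂ) (integrable_torusMeasure (X.continuous_fn v))
      simp only [RCLike.re_to_complex] at this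
      rw [this, integral_fn]; simp
    rw [integral_add (integrable_torusMeasure (by fun_prop))
      (integrable_torusMeasure (by fun_prop)),
      integral_add (integrable_torusMeasure (by fun_prop))
      (integrable_torusMeasure (by fun_prop)), hre, integral_div]
    simp
  rw [← h]
  refine integral_mono (integrable_torusMeasure (by fun_prop))
    (integrable_torusMeasure (by fun_prop)) fun x => ?_
  simp only
  set z := X.fn v x
  have h1 : ‖1 + z‖ ^ 2 = 1 + 2 * z.re + ‖z‖ ^ 2 := by
    rw [Complex.sq_norm, Complex.sq_norm, Complex.normSq_apply, Complex.normSq_apply]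
    simp
    ring
  nlinarith [sq_nonneg (‖1 + z‖ - 1)]

lemma one_comp (v : ℕ × ℕ) (X Y : WaveConfig) : (comp v X Y).one v = X.one v * Y.one v := by
  have h := integral_comp v X Y v (F := fun z => ‖1 + z‖) (by fun_prop)
  rw [one, h]
  have e : ∀ x y, ‖1 + (X.fn v x + (1 + X.fn v x) * Y.fn v y)‖
      = ‖1 + X.fn v x‖ * ‖1 + Y.fn v y‖ := fun x y => by
    rw [← norm_mul]; congr 1; ring
  simp_rw [e, integral_mul_const, integral_const_mul]
  rfl

lemma nrm_comp_le (v : ℕ × ℕ) (X Y : WaveConfig) (a : ℕ × ℕ) :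
    (comp v X Y).nrm a ≤ X.nrm a + X.one v * Y.nrm a := by
  rw [nrm, integral_comp v X Y a (F := fun z => ‖z‖) (by fun_prop)]
  have h : ∫ y, (X.nrm a + X.one v * ‖Y.fn a y‖) ∂torusMeasure Y.ι
      = X.nrm a + X.one v * Y.nrm a := by
    rw [integral_add (integrable_const _) (integrable_torusMeasure (by fun_prop)),
      integral_const_mul]
    simp [nrm]
  rw [← h]
  refine integral_mono (integrable_torusMeasure (continuous_integral_torus (by fun_prop)))
    (integrable_torusMeasure (by fun_prop)) fun y => ?_
  have h2 : X.nrm a + X.one v * ‖Y.fn a y‖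
      = ∫ x, (‖X.fn a x‖ + ‖1 + X.fn v x‖ * ‖Y.fn a y‖) ∂torusMeasure X.ι := by
    rw [integral_add (integrable_torusMeasure (by fun_prop))
      (integrable_torusMeasure (by fun_prop)), integral_mul_const]
    rfl
  simp only
  rw [h2]
  refine integral_mono (integrable_torusMeasure (by fun_prop))
    (integrable_torusMeasure (by fun_prop)) fun x => ?_
  exact (norm_add_le _ _).trans (by rw [norm_mul])

lemma norm_le_integral (X : WaveConfig) (v a : ℕ × ℕ) (c : ℂ) :
    ‖c‖ ≤ ∫ x, ‖X.fn a x + (1 + X.fn v x) * c‖ ∂torusMeasure X.ι := by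
  have h : ∫ x, (X.fn a x + (1 + X.fn v x) * c) ∂torusMeasure X.ι = c := by
    rw [integral_add (integrable_torusMeasure (by fun_prop))
      (integrable_torusMeasure (by fun_prop)), integral_mul_const,
      integral_add (integrable_const _) (integrable_torusMeasure (by fun_prop)),
      integral_fn, integral_fn]
    simp
  calc ‖c‖ = ‖∫ x, (X.fn a x + (1 + X.fn v x) * c) ∂torusMeasure X.ι‖ := by rw [h]
    _ ≤ _ := norm_integral_le_integral_norm _

lemma nrm_sub_le_integral (X : WaveConfig) (v a : ℕ × ℕ) (c : ℂ) :
    X.nrm a - X.one v * ‖c‖ ≤ ∫ x, ‖X.fn a x + (1 + X.fn v x) * c‖ ∂torusMeasure X.ι := by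
  have h2 : X.nrm a - X.one v * ‖c‖
      = ∫ x, (‖X.fn a x‖ - ‖1 + X.fn v x‖ * ‖c‖) ∂torusMeasure X.ι := by
    rw [integral_sub (integrable_torusMeasure (by fun_prop))
      (integrable_torusMeasure (by fun_prop)), integral_mul_const]
    rfl
  rw [h2]
  refine integral_mono (integrable_torusMeasure (by fun_prop))
    (integrable_torusMeasure (by fun_prop)) fun x => ?_
  simp only
  rw [← norm_mul]
  exact norm_sub_le_norm_add _ _

lemma le_nrm_comp (v : ℕ × ℕ) (X Y : WaveConfig) (b : ℕ × ℕ) (hX : X.one v ≤ 2)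
    {k : (Y.ι → UnitAddCircle) → ℝ} (hk : Continuous k) (hk0 : ∀ y, 0 ≤ k y)
    (hk1 : ∀ y, k y ≤ 1) :
    Y.nrm b + (∫ y, k y ∂torusMeasure Y.ι) * X.nrm b
      - 3 * ∫ y, k y * ‖Y.fn b y‖ ∂torusMeasure Y.ι ≤ (comp v X Y).nrm b := by
  rw [nrm, nrm, nrm, integral_comp v X Y b (F := fun z => ‖z‖) (by fun_prop),
    ← integral_mul_const, ← integral_const_mul,
    ← integral_add (integrable_torusMeasure (by fun_prop)) (integrable_torusMeasure (by fun_prop)),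
    ← integral_sub (integrable_torusMeasure (by fun_prop)) (integrable_torusMeasure (by fun_prop))]
  refine integral_mono (integrable_torusMeasure (by fun_prop))
    (integrable_torusMeasure (continuous_integral_torus (by fun_prop))) fun y => ?_
  have h1 := norm_le_integral X v b (Y.fn b y)
  have h2 := nrm_sub_le_integral X v b (Y.fn b y)
  have h3 : X.one v * ‖Y.fn b y‖ ≤ 2 * ‖Y.fn b y‖ := by gcongr
  simp only
  unfold nrm at h2
  nlinarith [hk0 y, hk1 y, mul_nonneg (hk0 y) (sub_nonneg.2 h3),
    mul_le_mul_of_nonneg_left h2 (hk0 y),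
    mul_le_mul_of_nonneg_left h1 (sub_nonneg.2 (hk1 y))]

/-- A one-variable trigonometric sum, normalised so that the exponent `v` turns it into
`∑ u s e(n s x)`. -/
def wave {κ : Type} [Fintype κ] (n : κ → ℤ) (hn : ∀ s, n s ≠ 0) (u : κ → ℂ) (v : ℕ × ℕ) (t : ℕ)
    (ht : 1 ≤ t) : WaveConfig where
  ι := Unit
  κ := κ
  rank := fun _ => 0
  rank_injective := fun _ _ _ => rfl
  scale := fun _ => t
  one_le_scale := fun _ => ht
  freq := fun s _ => n s
  top := fun _ => ()
  coef := fun s => u s / ((2 * (π : ℂ) * Complex.I * (n s : ℂ)) ^ v.1 * (t : ℂ) ^ v.2)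
  freq_top := hn
  freq_above := fun _ _ h => (lt_irrefl _ h).elim

lemma fn_wave_self {κ : Type} [Fintype κ] (n : κ → ℤ) (hn : ∀ s, n s ≠ 0) (u : κ → ℂ) (v : ℕ × ℕ)
    (t : ℕ) (ht : 1 ≤ t) (x : Unit → UnitAddCircle) :
    (wave n hn u v t ht).fn v x = ∑ s, u s * fourier (n s) (x ()) := by
  unfold fn
  refine Finset.sum_congr rfl fun s _ => ?_
  have h : (wave n hn u v t ht).coef s * (wave n hn u v t ht).sym v s = u s :=
    div_mul_cancel₀ _ ((wave n hn u v t ht).sym_ne_zero v s)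
  rw [h]
  congr 1
  change ∏ i : Unit, (fourier (n s) (x i) : ℂ) = _
  simp

lemma exists_nrm_wave_le {κ : Type} [Fintype κ] (n : κ → ℤ) (hn : ∀ s, n s ≠ 0) (u : κ → ℂ)
    (v a : ℕ × ℕ) (hav : a.2 < v.2) :
    ∃ C : ℝ, ∀ t, ∀ ht : 1 ≤ t, (wave n hn u v t ht).nrm a ≤ C / t := by
  let g : κ → ℝ := fun s => ‖u s / (2 * (π : ℂ) * Complex.I * (n s : ℂ)) ^ v.1 *
    (2 * (π : ℂ) * Complex.I * (n s : ℂ)) ^ a.1‖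
  refine ⟨∑ s, g s, fun t ht => ?_⟩
  have ht' : (1 : ℝ) ≤ t := by exact_mod_cast ht
  have key : ∀ x, ‖(wave n hn u v t ht).fn a x‖ ≤ (∑ s, g s) / t := by
    intro x
    unfold fn
    refine (norm_sum_le _ _).trans ?_
    rw [Finset.sum_div]
    refine Finset.sum_le_sum fun s _ => ?_
    have h1 : ‖(wave n hn u v t ht).coef s * (wave n hn u v t ht).sym a s‖
        = g s * ((t : ℝ) ^ a.2 / (t : ℝ) ^ v.2) := by
      have : (wave n hn u v t ht).coef s * (wave n hn u v t ht).sym a s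
          = (u s / (2 * (π : ℂ) * Complex.I * (n s : ℂ)) ^ v.1 *
            (2 * (π : ℂ) * Complex.I * (n s : ℂ)) ^ a.1) * ((t : ℂ) ^ a.2 / (t : ℂ) ^ v.2) := by
        change u s / ((2 * (π : ℂ) * Complex.I * (n s : ℂ)) ^ v.1 * (t : ℂ) ^ v.2) *
          ((2 * (π : ℂ) * Complex.I * (n s : ℂ)) ^ a.1 * (t : ℂ) ^ a.2) = _
        rw [div_mul_eq_div_div]
        ring
      rw [this, norm_mul, norm_div, norm_pow, norm_pow]
      simp [g]
    have h2 : ‖(UnitAddTorus.mFourier ((wave n hn u v t ht).freq s) x : ℂ)‖ ≤ 1 := by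
      have := (UnitAddTorus.mFourier ((wave n hn u v t ht).freq s)).norm_coe_le_norm x
      rwa [UnitAddTorus.mFourier_norm] at this
    have h3 : (t : ℝ) ^ a.2 / (t : ℝ) ^ v.2 ≤ 1 / t := by
      rw [div_le_div_iff₀ (by positivity) (by positivity), one_mul, ← pow_succ]
      exact pow_le_pow_right₀ ht' hav
    rw [norm_mul, h1]
    calc g s * ((t : ℝ) ^ a.2 / (t : ℝ) ^ v.2) * _ ≤ g s * (1 / t) * 1 := by
          have : 0 ≤ g s := norm_nonneg _
          gcongr
      _ = g s / t := by ring
  have := integral_mono (μ := torusMeasure (wave n hn u v t ht).ι)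
    (integrable_torusMeasure (by fun_prop)) (integrable_const _) key
  simpa [nrm] using this

lemma sum_fourier_sub (r : ℕ) (z : UnitAddCircle) :
    ∑ p : Fin r × Fin r, (fourier ((p.1 : ℤ) - (p.2 : ℤ)) z : ℂ)
      = ((‖∑ j : Fin r, (fourier (j : ℤ) z : ℂ)‖ ^ 2 : ℝ) : ℂ) := by
  have h : ((‖∑ j : Fin r, (fourier (j : ℤ) z : ℂ)‖ ^ 2 : ℝ) : ℂ)
      = (∑ j : Fin r, (fourier (j : ℤ) z : ℂ)) *
        (starRingEnd ℂ) (∑ j : Fin r, (fourier (j : ℤ) z : ℂ)) := by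
    rw [Complex.mul_conj, Complex.normSq_eq_norm_sq]
  rw [h, map_sum, Finset.sum_mul_sum, Fintype.sum_prod_type]
  refine Finset.sum_congr rfl fun j _ => Finset.sum_congr rfl fun k _ => ?_
  rw [sub_eq_add_neg, fourier_add, fourier_neg]

lemma integral_fourier_unit (m : ℤ) :
    ∫ x, (fourier m (x ()) : ℂ) ∂torusMeasure Unit = if m = 0 then 1 else 0 := by
  have h := integral_mFourier (ι := Unit) (fun _ => m)
  simpa [UnitAddTorus.mFourier, funext_iff] using h

lemma integral_sum_fourier_sub (r : ℕ) :
    ∫ x, ∑ p : Fin r × Fin r, (fourier ((p.1 : ℤ) - (p.2 : ℤ)) (x ()) : ℂ) ∂torusMeasure Unit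
      = r := by
  rw [integral_finsetSum _ fun s _ => integrable_torusMeasure (by fun_prop)]
  simp_rw [integral_fourier_unit, Fintype.sum_prod_type, sub_eq_zero]
  simp [Fin.val_inj]

lemma integral_sum_fourier_sub_mul (r : ℕ) :
    ∫ x, (∑ p : Fin (r + 1) × Fin (r + 1), (fourier ((p.1 : ℤ) - (p.2 : ℤ)) (x ()) : ℂ)) *
      fourier 1 (x ()) ∂torusMeasure Unit = r := by
  simp_rw [Finset.sum_mul, ← fourier_add]
  rw [integral_finsetSum _ fun s _ => integrable_torusMeasure (by fun_prop)]
  simp_rw [integral_fourier_unit, Fintype.sum_prod_type]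
  have h : ∀ j k : ℕ, (j : ℤ) - (k : ℤ) + 1 = 0 ↔ j + 1 = k := fun j k => by omega
  simp_rw [h]
  have h2 : ∀ j : Fin (r + 1), (∑ k : Fin (r + 1), if (j : ℕ) + 1 = (k : ℕ) then (1 : ℂ) else 0)
      = if (j : ℕ) < r then 1 else 0 := by
    intro j
    rw [Fin.sum_univ_eq_sum_range (fun k => if (j : ℕ) + 1 = k then (1 : ℂ) else 0),
      Finset.sum_ite_eq]
    simp
  simp_rw [h2]
  rw [Fin.sum_univ_eq_sum_range (fun k => if k < r then (1 : ℂ) else 0), Finset.sum_range_succ]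
  rw [Finset.sum_congr rfl fun k hk => if_pos (Finset.mem_range.1 hk)]
  simp

lemma exists_concentrated_wave (v : ℕ × ℕ) (A : Finset (ℕ × ℕ)) (hA : ∀ a ∈ A, a.2 < v.2) {δ : ℝ}
    (hδ : 0 < δ) :
    ∃ W : WaveConfig, ∃ k : (W.ι → UnitAddCircle) → ℝ, Continuous k ∧ (∀ x, 0 ≤ k x) ∧
      (∀ x, k x ≤ 1) ∧ ∫ x, k x ∂torusMeasure W.ι = 1 / 2 ∧ W.one v = 1 ∧
      ∫ x, k x * ‖1 + W.fn v x‖ ∂torusMeasure W.ι ≤ δ ∧ ∀ a ∈ A, W.nrm a ≤ δ := by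
  obtain ⟨r, hr⟩ := exists_nat_gt (1 / δ)
  let n : Fin (r + 1) × Fin (r + 1) → ℤ := fun p => if p.1 = p.2 then 1 else (p.1 : ℤ) - (p.2 : ℤ)
  let u : Fin (r + 1) × Fin (r + 1) → ℂ := fun p => if p.1 = p.2 then 0 else 1 / (r + 1)
  have hn : ∀ p, n p ≠ 0 := fun p => by
    simp only [n]
    split_ifs with h
    · exact one_ne_zero
    · rw [sub_ne_zero]
      exact fun h' => h (Fin.ext (by exact_mod_cast h'))
  choose! C hC using fun a (ha : a ∈ A) => exists_nrm_wave_le n hn u v a (hA a ha)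
  obtain ⟨t, ht⟩ := exists_nat_gt (∑ a ∈ A, |C a| / δ)
  have ht1 : 1 ≤ t := by
    have : (0 : ℝ) < t := lt_of_le_of_lt (Finset.sum_nonneg fun a _ => by positivity) ht
    exact_mod_cast this
  have hr0 : (r : ℂ) + 1 ≠ 0 := by exact_mod_cast Nat.succ_ne_zero r
  let w : (Unit → UnitAddCircle) → ℂ := fun x =>
    (1 / ((r : ℂ) + 1)) * ∑ p : Fin (r + 1) × Fin (r + 1),
      (fourier ((p.1 : ℤ) - (p.2 : ℤ)) (x ()) : ℂ)
  have hw : ∀ x : Unit → UnitAddCircle, 1 + (wave n hn u v t ht1).fn v x = w x := by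
    intro x
    rw [fn_wave_self]
    have h1 : (1 : ℂ) = ∑ p : Fin (r + 1) × Fin (r + 1),
        if p.1 = p.2 then 1 / ((r : ℂ) + 1) else 0 := by
      rw [Fintype.sum_prod_type]
      simp [hr0]
    rw [h1, ← Finset.sum_add_distrib]
    simp only [w]
    rw [Finset.mul_sum]
    refine Finset.sum_congr rfl fun p _ => ?_
    by_cases hp : p.1 = p.2 <;> simp [hp, u, n]
  have hwn : ∀ x, ((‖w x‖ : ℝ) : ℂ) = w x := by
    intro x
    simp only [w]
    rw [sum_fourier_sub, norm_mul, Complex.norm_real]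
    have : ‖(1 : ℂ) / ((r : ℂ) + 1)‖ = 1 / ((r : ℝ) + 1) := by
      rw [norm_div, norm_one]
      congr 1
      exact_mod_cast Complex.norm_natCast (r + 1)
    rw [this]
    simp
  have hwc : Continuous w := by fun_prop
  let k : (Unit → UnitAddCircle) → ℝ := fun x => (1 - (fourier 1 (x ()) : ℂ).re) / 2
  have hkc : Continuous k := by fun_prop
  have hf1 : ∀ x : Unit → UnitAddCircle, |(fourier 1 (x ()) : ℂ).re| ≤ 1 := fun x =>
    (Complex.abs_re_le_norm _).trans (by rw [fourier_apply]; exact (Circle.norm_coe _).le)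
  have hint1 : ∫ x, (fourier 1 (x ()) : ℂ).re ∂torusMeasure Unit = 0 := by
    have := integral_re (𝕜 := ℂ) (integrable_torusMeasure
      (f := fun x : Unit → UnitAddCircle => (fourier 1 (x ()) : ℂ)) (by fun_prop))
    simp only [RCLike.re_to_complex] at this
    rw [this, integral_fourier_unit]; simp
  have hint2 : ∫ x, ‖w x‖ ∂torusMeasure Unit = 1 := by
    have h : ((∫ x, ‖w x‖ ∂torusMeasure Unit : ℝ) : ℂ) = 1 := by
      rw [← integral_complex_ofReal]
      simp_rw [hwn, w]
      rw [integral_const_mul, integral_sum_fourier_sub]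
      push_cast
      field_simp
    exact_mod_cast h
  have hint3 : ∫ x, ‖w x‖ * (fourier 1 (x ()) : ℂ).re ∂torusMeasure Unit = r / (r + 1) := by
    have h : ∫ x, w x * (fourier 1 (x ()) : ℂ) ∂torusMeasure Unit
        = (((r : ℝ) / (r + 1) : ℝ) : ℂ) := by
      simp only [w, mul_assoc]
      rw [integral_const_mul, integral_sum_fourier_sub_mul]
      push_cast
      field_simp
    have := integral_re (𝕜 := ℂ) (integrable_torusMeasure
      (f := fun x : Unit → UnitAddCircle => w x * (fourier 1 (x ()) : ℂ)) (by fun_prop))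
    rw [h] at this
    simp only [RCLike.re_to_complex, Complex.ofReal_re] at this
    rw [← this]
    refine integral_congr_ae (Filter.Eventually.of_forall fun x => ?_)
    simp only
    conv_rhs => rw [← hwn x]
    rw [Complex.re_ofReal_mul]
  refine ⟨wave n hn u v t ht1, k, hkc, fun x => ?_, fun x => ?_, ?_, ?_, ?_, fun a ha => ?_⟩
  · have := (abs_le.1 (hf1 x)).2
    simp only [k]; linarith
  · have := (abs_le.1 (hf1 x)).1
    simp only [k]; linarith
  · change ∫ x, k x ∂torusMeasure Unit = 1 / 2
    simp only [k]
    rw [integral_div, integral_sub (integrable_const _) (integrable_torusMeasure (by fun_prop)),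
      hint1]
    simp
  · change ∫ x : Unit → UnitAddCircle, ‖1 + (wave n hn u v t ht1).fn v x‖ ∂torusMeasure Unit = 1
    simp_rw [hw]
    exact hint2
  · change ∫ x : Unit → UnitAddCircle, k x * ‖1 + (wave n hn u v t ht1).fn v x‖
      ∂torusMeasure Unit ≤ δ
    simp_rw [hw]
    have e : ∀ x, k x * ‖w x‖ = (‖w x‖ - ‖w x‖ * (fourier 1 (x ()) : ℂ).re) / 2 := fun x => by
      simp only [k]; ring
    simp_rw [e]
    rw [integral_div, integral_sub (integrable_torusMeasure (by fun_prop))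
      (integrable_torusMeasure (by fun_prop)), hint2, hint3]
    have hr1 : (0 : ℝ) < r + 1 := by positivity
    rw [one_sub_div hr1.ne', add_sub_cancel_left]
    rw [div_lt_iff₀ hδ] at hr
    rw [div_div, div_le_iff₀ (by positivity)]
    nlinarith
  · refine (hC a ha t ht1).trans ?_
    have ht0 : (0 : ℝ) < t := by exact_mod_cast ht1
    rw [div_le_iff₀ ht0]
    have h1 : |C a| / δ ≤ ∑ a ∈ A, |C a| / δ :=
      Finset.single_le_sum (f := fun a => |C a| / δ) (fun a _ => by positivity) ha
    have h2 := (h1.trans_lt ht).le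
    rw [div_le_iff₀ hδ] at h2
    linarith [le_abs_self (C a)]

lemma sub_nrm_le (v : ℕ × ℕ) (W X : WaveConfig) (b : ℕ × ℕ) (hW : W.one v = 1) :
    X.nrm b - W.nrm b ≤ (comp v W X).nrm b := by
  rw [nrm, nrm, nrm, integral_comp v W X b (F := fun z => ‖z‖) (by fun_prop)]
  have e : ∫ y, ‖X.fn b y‖ ∂torusMeasure X.ι - ∫ x, ‖W.fn b x‖ ∂torusMeasure W.ι
      = ∫ y, (‖X.fn b y‖ - ∫ x, ‖W.fn b x‖ ∂torusMeasure W.ι) ∂torusMeasure X.ι := by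
    rw [integral_sub (integrable_torusMeasure (by fun_prop)) (integrable_const _)]
    simp
  rw [e]
  refine integral_mono (integrable_torusMeasure (by fun_prop))
    (integrable_torusMeasure (continuous_integral_torus (by fun_prop))) fun y => ?_
  have h2 : ‖X.fn b y‖ - ∫ x, ‖W.fn b x‖ ∂torusMeasure W.ι
      = ∫ x, (‖1 + W.fn v x‖ * ‖X.fn b y‖ - ‖W.fn b x‖) ∂torusMeasure W.ι := by
    rw [integral_sub (integrable_torusMeasure (by fun_prop))
      (integrable_torusMeasure (by fun_prop)), integral_mul_const]
    unfold one at hW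
    rw [hW, one_mul]
  simp only
  rw [h2]
  refine integral_mono (integrable_torusMeasure (by fun_prop))
    (integrable_torusMeasure (by fun_prop)) fun x => ?_
  simp only
  rw [← norm_mul, add_comm (W.fn b x)]
  exact norm_sub_le_norm_add _ _

lemma integral_mul_norm_comp_le (v : ℕ × ℕ) (W X : WaveConfig) (b : ℕ × ℕ)
    {k : (W.ι → UnitAddCircle) → ℝ} (hk : Continuous k) (hk0 : ∀ y, 0 ≤ k y)
    (hk1 : ∀ y, k y ≤ 1) :
    ∫ z, k (fun i => z (Sum.inl i)) * ‖(comp v W X).fn b z‖ ∂torusMeasure (comp v W X).ι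
      ≤ W.nrm b + (∫ x, k x * ‖1 + W.fn v x‖ ∂torusMeasure W.ι) * X.nrm b := by
  have h := integral_torusMeasure_sum (ι := W.ι) (κ := X.ι)
    (f := fun z => k (fun i => z (Sum.inl i)) * ‖(comp v W X).fn b z‖)
    ((by fun_prop : Continuous fun z : W.ι ⊕ X.ι → UnitAddCircle => k (fun i => z (Sum.inl i))).mul
      (continuous_fn (comp v W X) b).norm)
  simp_rw [fn_comp, Sum.elim_inl] at h
  refine h.le.trans ?_
  set κ := ∫ x, k x * ‖1 + W.fn v x‖ ∂torusMeasure W.ι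
  have e : W.nrm b + κ * X.nrm b = ∫ y, (W.nrm b + κ * ‖X.fn b y‖) ∂torusMeasure X.ι := by
    rw [integral_add (integrable_const _) (integrable_torusMeasure (by fun_prop)),
      integral_const_mul]
    simp [nrm]
  rw [e]
  refine integral_mono (integrable_torusMeasure (continuous_integral_torus (by fun_prop)))
    (integrable_torusMeasure (by fun_prop)) fun y => ?_
  have h2 : W.nrm b + κ * ‖X.fn b y‖
      = ∫ x, (‖W.fn b x‖ + k x * ‖1 + W.fn v x‖ * ‖X.fn b y‖) ∂torusMeasure W.ι := by
    rw [integral_add (integrable_torusMeasure (by fun_prop))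
      (integrable_torusMeasure (by fun_prop)), integral_mul_const]
    rfl
  simp only
  rw [h2]
  refine integral_mono (integrable_torusMeasure (by fun_prop))
    (integrable_torusMeasure (by fun_prop)) fun x => ?_
  simp only
  have h3 := norm_add_le (W.fn b x) ((1 + W.fn v x) * X.fn b y)
  rw [norm_mul] at h3
  have h4 := mul_le_mul_of_nonneg_left h3 (hk0 x)
  nlinarith [mul_nonneg (sub_nonneg.2 (hk1 x)) (norm_nonneg (W.fn b x))]

lemma exists_modulation (v b : ℕ × ℕ) (hb : b.2 < v.2) (J : Finset (ℕ × ℕ))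
    (hJ : ∀ a ∈ J, a.2 < v.2) (X : WaveConfig) {δ : ℝ} (hδ : 0 < δ) :
    ∃ Y : WaveConfig, ∃ k : (Y.ι → UnitAddCircle) → ℝ, Continuous k ∧ (∀ x, 0 ≤ k x) ∧
      (∀ x, k x ≤ 1) ∧ ∫ x, k x ∂torusMeasure Y.ι = 1 / 2 ∧ Y.one v = X.one v ∧
      X.nrm b - δ ≤ Y.nrm b ∧
      ∫ x, k x * ‖Y.fn b x‖ ∂torusMeasure Y.ι ≤ δ ∧ ∀ a ∈ J, Y.nrm a ≤ X.nrm a + δ := by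
  have hN := X.nrm_nonneg b
  let δ' := δ / (X.nrm b + 1)
  have hδ' : 0 < δ' := by positivity
  have hle : δ' * (X.nrm b + 1) = δ := div_mul_cancel₀ _ (by positivity)
  have hδδ : δ' ≤ δ := by nlinarith
  obtain ⟨W, k, hk, hk0, hk1, hki, hW1, hWk, hWJ⟩ := exists_concentrated_wave v (insert b J)
    (by simpa [hb] using hJ) hδ'
  have hWb := hWJ b (Finset.mem_insert_self _ _)
  refine ⟨comp v W X, fun z => k fun i => z (Sum.inl i), ?_, fun _ => hk0 _, fun _ => hk1 _,
    ?_, ?_, ?_, ?_, fun a ha => ?_⟩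
  · exact hk.comp (continuous_pi fun i => continuous_apply (Sum.inl i : W.ι ⊕ X.ι))
  · have h := integral_torusMeasure_sum (ι := W.ι) (κ := X.ι)
      (f := fun z => k fun i => z (Sum.inl i))
      (hk.comp (continuous_pi fun i => continuous_apply (Sum.inl i : W.ι ⊕ X.ι)))
    refine h.trans ?_
    simp [hki]
  · rw [one_comp, hW1, one_mul]
  · have := sub_nrm_le v W X b hW1
    linarith
  · refine (integral_mul_norm_comp_le v W X b hk hk0 hk1).trans ?_
    rw [← hle]
    nlinarith
  · have h1 := nrm_comp_le v W X a
    have h2 := hWJ a (Finset.mem_insert_of_mem ha)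
    rw [hW1] at h1
    linarith

/-- If the exponent `b` is dominated by `v` and by exponents in `J`, all of weight smaller than that
of `v`, then the exponents in `J` suffice. -/
lemma domination_remove (v b : ℕ × ℕ) (hb : b.2 < v.2) (J : Finset (ℕ × ℕ))
    (hJ : ∀ a ∈ J, a.2 < v.2) {C : ℝ} (hC : 0 ≤ C)
    (h : ∀ X : WaveConfig, X.nrm b ≤ C * (X.nrm v + ∑ a ∈ J, X.nrm a)) (X : WaveConfig) :
    X.nrm b ≤ 4 * C * ∑ a ∈ J, X.nrm a := by
  let Φ : WaveConfig → ℝ := fun X => 2 * C * (X.one v + ∑ a ∈ J, X.nrm a) - X.nrm b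
  have hΦ : ∀ X, X.nrm b - 2 * C ≤ Φ X := fun X => by
    have h1 := h X
    have h2 := mul_le_mul_of_nonneg_left (X.nrm_le_one_add v) hC
    simp only [Φ]
    linarith
  have hbdd : BddBelow (Set.range Φ) := ⟨-(2 * C), by
    rintro _ ⟨X, rfl⟩
    linarith [hΦ X, X.nrm_nonneg b]⟩
  set g := sInf (Set.range Φ)
  set s := ∫ x, ‖X.fn v x‖ ^ 2 ∂torusMeasure X.ι
  have hs : 0 ≤ s := integral_nonneg fun x => by positivity
  have hSJ : 0 ≤ ∑ a ∈ J, X.nrm a := Finset.sum_nonneg fun a _ => X.nrm_nonneg a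
  have key : ∀ ε : ℝ, 0 < ε → ε ≤ 1 → ε ^ 2 * s ≤ 2 →
      X.nrm b ≤ 4 * C * ∑ a ∈ J, X.nrm a
        + ε * (10 + 8 * C * J.card + s * (2 * g + 2 + 2 * C)) := by
    intro ε hε hε1 hεs
    obtain ⟨_, ⟨V, rfl⟩, hV⟩ := exists_lt_of_csInf_lt (Set.range_nonempty_iff_nonempty.2 ⟨X⟩)
      (show sInf (Set.range Φ) < g + ε ^ 2 by have := pow_pos hε 2; linarith)
    obtain ⟨Y, k, hk, hk0, hk1, hki, hY1, hYb, hYk, hYJ⟩ :=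
      exists_modulation v b hb J hJ V (pow_pos hε 2)
    let Z := comp v (X.smul ε) Y
    have hgZ : g ≤ Φ Z := csInf_le hbdd ⟨Z, rfl⟩
    have hεn : ‖(ε : ℂ)‖ = ε := by simp [abs_of_pos hε]
    have hρ : (X.smul ε).one v ≤ 1 + ε ^ 2 * s / 2 := by
      refine ((X.smul ε).one_le v).trans_eq ?_
      have : ∫ x, ‖(X.smul ε).fn v x‖ ^ 2 ∂torusMeasure (X.smul ε).ι = ε ^ 2 * s := by
        simp only [s]
        rw [← integral_const_mul]
        refine integral_congr_ae (Filter.Eventually.of_forall fun x => ?_)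
        simp only
        rw [fn_smul (ε : ℂ) X v x, norm_mul, hεn, mul_pow]
      rw [this]
    have hρ0 := (X.smul ε).one_nonneg v
    set ρ := (X.smul ε).one v
    have hZb := le_nrm_comp v (X.smul ε) Y b (by linarith) hk hk0 hk1
    have hZ1 : Z.one v = ρ * V.one v := by rw [one_comp, hY1]
    have hZJ : ∑ a ∈ J, Z.nrm a
        ≤ ε * ∑ a ∈ J, X.nrm a + ρ * (∑ a ∈ J, V.nrm a + J.card * ε ^ 2) := by
      have : ε * ∑ a ∈ J, X.nrm a + ρ * (∑ a ∈ J, V.nrm a + J.card * ε ^ 2)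
          = ∑ a ∈ J, (ε * X.nrm a + ρ * (V.nrm a + ε ^ 2)) := by
        rw [Finset.sum_add_distrib, ← Finset.mul_sum, ← Finset.mul_sum, Finset.sum_add_distrib,
          Finset.sum_const, nsmul_eq_mul]
      rw [this]
      refine Finset.sum_le_sum fun a ha => ?_
      refine (nrm_comp_le v (X.smul ε) Y a).trans ?_
      rw [nrm_smul, hεn]
      have := mul_le_mul_of_nonneg_left (hYJ a ha) hρ0
      linarith
    rw [nrm_smul, hεn, hki] at hZb
    have hV1 := V.one_nonneg v
    have hVJ : 0 ≤ ∑ a ∈ J, V.nrm a := Finset.sum_nonneg fun a _ => V.nrm_nonneg a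
    have hVb := hΦ V
    set T := V.one v + ∑ a ∈ J, V.nrm a with hT
    have hT0 : 0 ≤ T := by positivity
    have hVΦ : Φ V = 2 * C * T - V.nrm b := rfl
    have hε2 : ε ^ 2 ≤ 1 := pow_le_one₀ hε.le hε1
    have hCT : 2 * C * T ≤ 2 * g + 2 + 2 * C := by linarith
    have hCT0 : 0 ≤ 2 * C * T := by positivity
    have hZsum : Z.one v + ∑ a ∈ J, Z.nrm a
        ≤ ρ * T + ε * ∑ a ∈ J, X.nrm a + ρ * (J.card * ε ^ 2) := by
      rw [hZ1, hT]; linarith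
    have hZΦ : Φ Z = 2 * C * (Z.one v + ∑ a ∈ J, Z.nrm a) - Z.nrm b := rfl
    have h2C := mul_le_mul_of_nonneg_left hZsum (by positivity : 0 ≤ 2 * C)
    have e1 : ρ * (2 * C * T) ≤ 2 * C * T + ε ^ 2 * s / 2 * (2 * g + 2 + 2 * C) := by
      have : ρ * (2 * C * T) ≤ (1 + ε ^ 2 * s / 2) * (2 * C * T) := by gcongr
      have : ε ^ 2 * s / 2 * (2 * C * T) ≤ ε ^ 2 * s / 2 * (2 * g + 2 + 2 * C) := by gcongr
      linarith
    have e2 : 2 * C * (ρ * (J.card * ε ^ 2)) ≤ 2 * C * (2 * (J.card * ε ^ 2)) := by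
      have : ρ ≤ 2 := by linarith
      gcongr
    have fin : ε * X.nrm b ≤ ε * (4 * C * ∑ a ∈ J, X.nrm a
        + ε * (10 + 8 * C * J.card + s * (2 * g + 2 + 2 * C))) := by
      have hZb' : V.nrm b - ε ^ 2 + 1 / 2 * (ε * X.nrm b) - 3 * ε ^ 2 ≤ Z.nrm b := by
        refine le_trans ?_ hZb
        linarith
      nlinarith
    exact le_of_mul_le_mul_left fin hε
  set M := 10 + 8 * C * J.card + s * (2 * g + 2 + 2 * C)
  have hlim : Tendsto (fun ε : ℝ => 4 * C * ∑ a ∈ J, X.nrm a + ε * M) (𝓝[>] 0)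
      (𝓝 (4 * C * ∑ a ∈ J, X.nrm a + 0 * M)) :=
    (Continuous.tendsto (by fun_prop) 0).mono_left nhdsWithin_le_nhds
  rw [zero_mul, add_zero] at hlim
  refine ge_of_tendsto hlim ?_
  have hev : ∀ᶠ ε : ℝ in 𝓝 0, ε ^ 2 * s < 2 :=
    (Continuous.tendsto (by fun_prop : Continuous fun ε : ℝ => ε ^ 2 * s) 0).eventually_lt_const
      (by simp)
  filter_upwards [self_mem_nhdsWithin, Ioc_mem_nhdsGT (zero_lt_one' ℝ),
    hev.filter_mono nhdsWithin_le_nhds] with ε h0 h1 h2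
  exact key ε h0 h1.2 h2.le

lemma exists_lower_weights_lt (A : Finset (ℕ × ℕ)) (b : ℕ × ℕ) {C : ℝ} (hC : 0 ≤ C) :
    ∃ X : WaveConfig, C * ∑ a ∈ A with a.2 < b.2, X.nrm a < X.nrm b := by
  choose! D hD using fun a (ha : a ∈ A.filter fun a => a.2 < b.2) =>
    exists_nrm_wave_le (fun _ : Unit => 1) (fun _ => one_ne_zero) (fun _ => 1) b a
      (Finset.mem_filter.1 ha).2
  obtain ⟨t, ht⟩ := exists_nat_gt (C * ∑ a ∈ A with a.2 < b.2, |D a|)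
  have ht0 : (0 : ℝ) < t := lt_of_le_of_lt (by positivity) ht
  have ht1 : 1 ≤ t := by exact_mod_cast ht0
  refine ⟨wave (fun _ : Unit => 1) (fun _ => one_ne_zero) (fun _ => 1) b t ht1, ?_⟩
  have h1 : (wave (fun _ : Unit => 1) (fun _ => one_ne_zero) (fun _ => 1) b t ht1).nrm b
      = 1 := by
    have e : ∀ x : Unit → UnitAddCircle,
        ‖(wave (fun _ : Unit => 1) (fun _ => one_ne_zero) (fun _ => 1) b t ht1).fn b x‖
          = 1 := fun x => by
      rw [fn_wave_self, Fintype.sum_unique, one_mul, fourier_apply]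
      exact Circle.norm_coe _
    have h2 : ∫ _ : Unit → UnitAddCircle, (1 : ℝ) ∂torusMeasure Unit = 1 := by simp
    exact (integral_congr_ae (Filter.Eventually.of_forall e)).trans h2
  rw [h1]
  calc C * ∑ a ∈ A with a.2 < b.2, _
      ≤ C * ∑ a ∈ A with a.2 < b.2, |D a| / t := by
        gcongr with a ha
        refine (hD a ha t ht1).trans ?_
        gcongr
        exact le_abs_self _
    _ = (C * ∑ a ∈ A with a.2 < b.2, |D a|) / t := by
        rw [← Finset.sum_div, mul_div_assoc]
    _ < 1 := by rwa [div_lt_one ht0]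

/-- An exponent is not dominated by finitely many other exponents with pairwise distinct weights. -/
theorem not_dominated (A : Finset (ℕ × ℕ)) (b : ℕ × ℕ)
    (hA : ∀ a ∈ A, ∀ a' ∈ A, a.2 = a'.2 → a = a') (hb : ∀ a ∈ A, a.2 ≠ b.2) (C : ℝ) :
    ∃ X : WaveConfig, C * ∑ a ∈ A, X.nrm a < X.nrm b := by
  have main : ∀ q, b.2 ≤ q → ∀ C : ℝ, 0 ≤ C →
      ∃ X : WaveConfig, C * ∑ a ∈ A with a.2 < q, X.nrm a < X.nrm b := by
    intro q hq
    induction q, hq using Nat.le_induction with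
    | base =>
      intro C hC
      exact exists_lower_weights_lt A b hC
    | succ q hq ih =>
      intro C hC
      by_cases hv : ∃ v ∈ A, v.2 = q
      · obtain ⟨v, hvA, rfl⟩ := hv
        have hbv : b.2 < v.2 := lt_of_le_of_ne hq (hb v hvA).symm
        obtain ⟨X, hX⟩ := ih (4 * C) (by positivity)
        by_contra! hcon
        have hfil : (A.filter fun a => a.2 < v.2 + 1)
            = insert v (A.filter fun a => a.2 < v.2) := by
          ext a
          simp only [Finset.mem_filter, Finset.mem_insert]
          constructor
          · rintro ⟨h1, h2⟩
            rcases (Nat.lt_succ_iff_lt_or_eq.1 h2) with h | h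
            · exact Or.inr ⟨h1, h⟩
            · exact Or.inl (hA a h1 v hvA h)
          · rintro (rfl | ⟨h1, h2⟩)
            · exact ⟨hvA, Nat.lt_succ_self _⟩
            · exact ⟨h1, h2.trans (Nat.lt_succ_self _)⟩
        have := domination_remove v b hbv (A.filter fun a => a.2 < v.2)
          (fun a ha => (Finset.mem_filter.1 ha).2) hC (fun X => by
            have := hcon X
            rwa [hfil, Finset.sum_insert (by simp)] at this) X
        linarith
      · push Not at hv
        have hfil : (A.filter fun a => a.2 < q + 1) = A.filter fun a => a.2 < q := by
          refine Finset.filter_congr fun a ha => ?_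
          have := hv a ha
          omega
        rw [hfil]
        exact ih C hC
  obtain ⟨X, hX⟩ := main (b.2 + ∑ a ∈ A, (a.2 + 1)) (Nat.le_add_right _ _) |C| (abs_nonneg _)
  refine ⟨X, lt_of_le_of_lt ?_ hX⟩
  have hfil : (A.filter fun a => a.2 < b.2 + ∑ a ∈ A, (a.2 + 1)) = A := by
    refine Finset.filter_true_of_mem fun a ha => ?_
    have := Finset.single_le_sum (f := fun a : ℕ × ℕ => a.2 + 1) (fun _ _ => Nat.zero_le _) ha
    omega
  rw [hfil]
  have : 0 ≤ ∑ a ∈ A, X.nrm a := Finset.sum_nonneg fun a _ => X.nrm_nonneg a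
  exact mul_le_mul_of_nonneg_right (le_abs_self C) this

end WaveConfig

/-- The character `x ↦ e^{2πix}`. -/
def expChar (x : ℝ) : ℂ := Complex.exp (2 * (π : ℂ) * Complex.I * (x : ℂ))

lemma expChar_add (x y : ℝ) : expChar (x + y) = expChar x * expChar y := by
  unfold expChar
  rw [← Complex.exp_add]
  congr 1
  push_cast
  ring

lemma expChar_zero : expChar 0 = 1 := by simp [expChar]

lemma norm_expChar (x : ℝ) : ‖expChar x‖ = 1 := by
  have : expChar x = Complex.exp (((2 * π * x : ℝ) : ℂ) * Complex.I) := by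
    unfold expChar
    congr 1
    push_cast
    ring
  rw [this, Complex.norm_exp_ofReal_mul_I]

section TwistedShift

variable {G : Type} [AddCommGroup G] (θ : G →+ G →+ ℝ)

lemma memℓp_twistedShift (x : G) (f : lp (fun _ : G => ℂ) 2) :
    Memℓp (fun m => expChar (θ x m / 2) * f (m - x)) 2 := by
  have h := (memℓp_gen_iff (p := 2) (by norm_num)).1 (lp.memℓp f)
  refine (memℓp_gen_iff (p := 2) (by norm_num)).2 ?_
  simp_rw [norm_mul, norm_expChar, one_mul]
  exact ((Equiv.subRight x).summable_iff).2 h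

/-- The shift by `x`, twisted by the bicharacter attached to `θ`. -/
def twistedShift (x : G) : lp (fun _ : G => ℂ) 2 →ₗᵢ[ℂ] lp (fun _ : G => ℂ) 2 where
  toFun f := ⟨fun m => expChar (θ x m / 2) * f (m - x), memℓp_twistedShift θ x f⟩
  map_add' f g := by
    ext m
    exact mul_add _ _ _
  map_smul' c f := by
    ext m
    simp
    ring
  norm_map' f := by
    have h2 : (0 : ℝ) < (2 : ENNReal).toReal := by norm_num
    change ‖(⟨fun m => expChar (θ x m / 2) * f (m - x), memℓp_twistedShift θ x f⟩ :
      lp (fun _ : G => ℂ) 2)‖ = ‖f‖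
    rw [lp.norm_eq_tsum_rpow h2, lp.norm_eq_tsum_rpow h2]
    congr 1
    simp_rw [norm_mul, norm_expChar, one_mul]
    exact (Equiv.subRight x).tsum_eq (fun m => ‖f m‖ ^ (2 : ENNReal).toReal)

lemma twistedShift_apply (x : G) (f : lp (fun _ : G => ℂ) 2) (m : G) :
    twistedShift θ x f m = expChar (θ x m / 2) * f (m - x) := rfl

lemma twistedShift_twistedShift (hθ : ∀ x y, θ x y = -θ y x) (x y : G)
    (f : lp (fun _ : G => ℂ) 2) :
    twistedShift θ x (twistedShift θ y f) = expChar (θ x y / 2) • twistedShift θ (x + y) f := by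
  ext m
  rw [lp.coeFn_smul, Pi.smul_apply, smul_eq_mul, twistedShift_apply, twistedShift_apply,
    twistedShift_apply, ← mul_assoc, ← mul_assoc, ← expChar_add, ← expChar_add, sub_sub]
  congr 2
  rw [map_sub, map_add, AddMonoidHom.add_apply, hθ y x]
  ring

lemma exists_twisted_rep [DecidableEq G] (hθ : ∀ x y, θ x y = -θ y x) :
    ∃ S : HilbertSetup, ∃ T : G → S.H →L[ℂ] S.H, ∃ e₀ : S.H, ‖e₀‖ = 1 ∧ T 0 = 1 ∧
      (∀ x y, T x * T y = expChar (θ x y / 2) • T (x + y)) ∧ (∀ x, star (T x) = T (-x)) ∧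
      ∀ x, x ≠ 0 → vecState e₀ (T x) = 0 := by
  have hxx : ∀ x, θ x x = 0 := fun x => by linarith [hθ x x]
  let T : G → lp (fun _ : G => ℂ) 2 →L[ℂ] lp (fun _ : G => ℂ) 2 := fun x =>
    (twistedShift θ x).toContinuousLinearMap
  have hT0 : T 0 = 1 := by
    ext f m
    simp [T, twistedShift_apply, expChar_zero]
  have hTT : ∀ x y, T x * T y = expChar (θ x y / 2) • T (x + y) := fun x y => by
    ext1 f
    exact twistedShift_twistedShift θ hθ x y f
  have hinv : ∀ x, T x * T (-x) = 1 := fun x => by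
    rw [hTT, add_neg_cancel, hT0, map_neg, hxx]
    simp [expChar_zero]
  have hiso : ∀ x, star (T x) * T x = 1 := fun x => by
    have := (ContinuousLinearMap.norm_map_iff_adjoint_comp_self (T x)).1
      (fun f => (twistedShift θ x).norm_map f)
    exact this
  refine ⟨⟨lp (fun _ : G => ℂ) 2⟩, T, lp.single 2 0 (1 : ℂ), ?_, hT0, hTT, fun x => ?_,
    fun x hx => ?_⟩
  · have := lp.norm_single (E := fun _ : G => ℂ) (p := 2) (by norm_num) (0 : G) (1 : ℂ)
    exact this.trans (by simp)
  · calc star (T x) = star (T x) * (T x * T (-x)) := by rw [hinv, mul_one]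
      _ = T (-x) := by rw [← mul_assoc, hiso, one_mul]
  · change inner ℂ (lp.single (E := fun _ : G => ℂ) 2 0 (1 : ℂ))
      (twistedShift θ x (lp.single 2 0 (1 : ℂ))) = 0
    rw [lp.inner_single_left, twistedShift_apply]
    simp [lp.single_apply, hx]

end TwistedShift

section Monomials

variable {G : Type} [AddCommGroup G] {θ : G →+ G →+ ℝ} {T : G → H →L[ℂ] H}

lemma coe_zpow_eq (hθ : ∀ x y, θ x y = -θ y x) (h0 : T 0 = 1)
    (hmul : ∀ x y, T x * T y = expChar (θ x y / 2) • T (x + y))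
    (hstar : ∀ x, star (T x) = T (-x)) {u : unitary (H →L[ℂ] H)} {x : G}
    (hu : (u : H →L[ℂ] H) = T x) (n : ℤ) : ((u ^ n : unitary (H →L[ℂ] H)) : H →L[ℂ] H)
      = T (n • x) := by
  have hxx : θ x x = 0 := by linarith [hθ x x]
  induction n using Int.induction_on with
  | zero => simp [h0]
  | succ n ih =>
    rw [zpow_add_one, Submonoid.coe_mul, ih, hu, hmul, map_zsmul, AddMonoidHom.zsmul_apply, hxx,
      add_smul, one_smul]
    simp [expChar_zero]
  | pred n ih =>
    have hinv : ((u⁻¹ : unitary (H →L[ℂ] H)) : H →L[ℂ] H) = T (-x) := by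
      rw [← hstar, ← hu]; rfl
    rw [zpow_sub_one, Submonoid.coe_mul, ih, hinv, hmul, map_zsmul, AddMonoidHom.zsmul_apply,
      map_neg, hxx, sub_smul, one_smul, ← sub_eq_add_neg]
    simp [expChar_zero]

lemma exists_coe_list_prod_eq {κ : Type} (h0 : T 0 = 1)
    (hmul : ∀ x y, T x * T y = expChar (θ x y / 2) • T (x + y))
    (u : κ → unitary (H →L[ℂ] H)) (x : κ → G) (hu : ∀ k, (u k : H →L[ℂ] H) = T (x k))
    (l : List κ) : ∃ ω : ℂ, ‖ω‖ = 1 ∧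
      (((l.map u).prod : unitary (H →L[ℂ] H)) : H →L[ℂ] H) = ω • T (l.map x).sum := by
  induction l with
  | nil => exact ⟨1, norm_one, by simp [h0]⟩
  | cons k l ih =>
    obtain ⟨ω, hω, h⟩ := ih
    refine ⟨ω * expChar (θ (x k) (l.map x).sum / 2), by rw [norm_mul, hω, norm_expChar, one_mul],
      ?_⟩
    rw [List.map_cons, List.prod_cons, List.map_cons, List.sum_cons, Submonoid.coe_mul, h, hu,
      mul_smul_comm, hmul, smul_smul]

end Monomials

/-- The alternating form on `ℤ^d` attached to a matrix. -/
def matrixForm {d : ℕ} (Θ : Matrix (Fin d) (Fin d) ℝ) :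
    (Fin d → ℤ) →+ (Fin d → ℤ) →+ ℝ :=
  AddMonoidHom.mk' (fun x => AddMonoidHom.mk' (fun y => ∑ k, ∑ l, Θ k l * x k * y l) fun y z => by
      simp_rw [← Finset.sum_add_distrib]
      refine Finset.sum_congr rfl fun k _ => Finset.sum_congr rfl fun l _ => ?_
      push_cast [Pi.add_apply]
      ring) fun x z => by
    refine AddMonoidHom.ext fun y => ?_
    rw [AddMonoidHom.add_apply]
    simp only [AddMonoidHom.mk'_apply, ← Finset.sum_add_distrib]
    refine Finset.sum_congr rfl fun k _ => Finset.sum_congr rfl fun l _ => ?_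
    push_cast [Pi.add_apply]
    ring

lemma matrixForm_apply {d : ℕ} (Θ : Matrix (Fin d) (Fin d) ℝ) (x y : Fin d → ℤ) :
    matrixForm Θ x y = ∑ k, ∑ l, Θ k l * x k * y l := rfl

lemma matrixForm_skew {d : ℕ} {Θ : Matrix (Fin d) (Fin d) ℝ} (hΘ : Matrix.transpose Θ = -Θ)
    (x y : Fin d → ℤ) : matrixForm Θ x y = -matrixForm Θ y x := by
  rw [matrixForm_apply, matrixForm_apply, Finset.sum_comm, ← Finset.sum_neg_distrib]
  refine Finset.sum_congr rfl fun l _ => ?_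
  rw [← Finset.sum_neg_distrib]
  refine Finset.sum_congr rfl fun k _ => ?_
  have : Θ k l = -Θ l k := by
    have := congrFun (congrFun hΘ l) k
    simpa using this
  rw [this]
  ring

lemma matrixForm_single {d : ℕ} (Θ : Matrix (Fin d) (Fin d) ℝ) (k l : Fin d) :
    matrixForm Θ (Pi.single k 1) (Pi.single l 1) = Θ k l := by
  rw [matrixForm_apply, Finset.sum_eq_single k, Finset.sum_eq_single l]
  · simp
  · intro j _ hj; simp [hj]
  · simp
  · intro j _ hj; simp [hj]
  · simp

section Torus

variable {d : ℕ} {Θ : Matrix (Fin d) (Fin d) ℝ} {T : (Fin d → ℤ) → H →L[ℂ] H}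

lemma exists_qMonoD_eq (hΘ : Matrix.transpose Θ = -Θ) (h0 : T 0 = 1)
    (hmul : ∀ x y, T x * T y = expChar (matrixForm Θ x y / 2) • T (x + y))
    (hstar : ∀ x, star (T x) = T (-x)) {U : Fin d → unitary (H →L[ℂ] H)}
    (hU : ∀ k, (U k : H →L[ℂ] H) = T (Pi.single k 1)) (γ : Fin d → ℤ) :
    ∃ ω : ℂ, ‖ω‖ = 1 ∧ qMonoD U γ = ω • T γ := by
  obtain ⟨ω, hω, h⟩ := exists_coe_list_prod_eq h0 hmul (fun k => U k ^ γ k)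
    (fun k => γ k • Pi.single k 1)
    (fun k => coe_zpow_eq (matrixForm_skew hΘ) h0 hmul hstar (hU k) (γ k)) (List.finRange d)
  refine ⟨ω, hω, ?_⟩
  rw [qMonoD, List.ofFn_eq_map, h, ← List.ofFn_eq_map, List.sum_ofFn]
  congr 2
  have : ∀ k, γ k • (Pi.single k 1 : Fin d → ℤ) = Pi.single k (γ k) := fun k => by
    rw [← Pi.single_smul]; simp
  simp_rw [this]
  exact Finset.univ_sum_single γ

lemma derivPolyD_sum_single {κ : Type} (s : Finset κ) (U : Fin d → unitary (H →L[ℂ] H))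
    (γ : κ → Fin d → ℤ) (c : κ → ℂ) (α : Fin d → ℕ) :
    derivPolyD U (∑ i ∈ s, Finsupp.single (γ i) (c i)) α
      = ∑ i ∈ s, ((∏ k : Fin d, (2 * (π : ℂ) * Complex.I * (γ i k : ℂ)) ^ (α k)) * c i) •
        qMonoD U (γ i) := by
  have h : ∀ c' : (Fin d → ℤ) →₀ ℂ, derivPolyD U c' α = Finsupp.linearCombination ℂ
      (fun γ : Fin d → ℤ => (∏ k : Fin d, (2 * (π : ℂ) * Complex.I * (γ k : ℂ)) ^ (α k)) •
        qMonoD U γ) c' := by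
    intro c'
    rw [Finsupp.linearCombination_apply, Finsupp.sum, derivPolyD]
    exact Finset.sum_congr rfl fun γ _ => by rw [smul_smul, mul_comm]
  rw [h, map_sum]
  refine Finset.sum_congr rfl fun i _ => ?_
  rw [Finsupp.linearCombination_single, smul_smul, mul_comm]

end Torus

section Transference

variable {G : Type} [AddCommGroup G] {θ : G →+ G →+ ℝ} {T : G → H →L[ℂ] H} {e₀ : H}
  {ι : Type} [Fintype ι] {a : ℕ → ι → G} {x y : ℕ → H →L[ℂ] H}
  {φ ψ : C(ι → UnitAddCircle, ℂ)}

/-- The operators `x n` are asymptotically the linear combinations of the `T (∑ k, m k • a n k)`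
with the coefficients of the trigonometric polynomial `φ`. -/
def HasAsympSymbol (T : G → H →L[ℂ] H) (a : ℕ → ι → G) (x : ℕ → H →L[ℂ] H)
    (φ : C(ι → UnitAddCircle, ℂ)) : Prop :=
  ∃ (κ : Type) (_ : Fintype κ) (m : κ → ι → ℤ) (c : κ → ℂ),
    Tendsto (fun n => x n - ∑ s, c s • T (∑ k, m s k • a n k)) atTop (𝓝 0) ∧
      φ = ∑ s, c s • UnitAddTorus.mFourier (m s)

lemma norm_twisted_le (hθ : ∀ x y, θ x y = -θ y x) (h0 : T 0 = 1)
    (hmul : ∀ x y, T x * T y = expChar (θ x y / 2) • T (x + y))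
    (hstar : ∀ x, star (T x) = T (-x)) (g : G) : ‖T g‖ ≤ 1 := by
  have hgg : θ g g = 0 := by linarith [hθ g g]
  have h1 : star (T g) * T g = 1 := by
    rw [hstar, hmul, neg_add_cancel, h0, map_neg, AddMonoidHom.neg_apply, hgg]
    simp [expChar_zero]
  have h2 : ‖T g‖ * ‖T g‖ ≤ 1 := by
    rw [← CStarRing.norm_star_mul_self, h1]
    exact ContinuousLinearMap.norm_id_le
  nlinarith [norm_nonneg (T g)]

lemma tendsto_expChar_sum (hχ : ∀ k l, Tendsto (fun n => expChar (θ (a n k) (a n l) / 2)) atTop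
    (𝓝 1)) (m m' : ι → ℤ) :
    Tendsto (fun n => expChar (θ (∑ k, m k • a n k) (∑ k, m' k • a n k) / 2)) atTop (𝓝 1) := by
  let S : AddSubgroup (ℕ → ℝ) :=
    { carrier := {f | Tendsto (fun n => expChar (f n)) atTop (𝓝 1)}
      add_mem' := fun {f g} hf hg => by
        have := Tendsto.mul hf hg
        simp_rw [← expChar_add, mul_one] at this
        exact this
      zero_mem' := by
        change Tendsto (fun _ : ℕ => expChar 0) atTop (𝓝 1)
        rw [expChar_zero]
        exact tendsto_const_nhds
      neg_mem' := fun {f} hf => by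
        have h1 := Tendsto.inv₀ hf one_ne_zero
        rw [inv_one] at h1
        refine h1.congr fun n => ?_
        refine inv_eq_of_mul_eq_one_left ?_
        rw [← expChar_add, Pi.neg_apply, neg_add_cancel, expChar_zero] }
  have h : (fun n => θ (∑ k, m k • a n k) (∑ k, m' k • a n k) / 2)
      = ∑ k, ∑ l, m k • m' l • fun n => θ (a n k) (a n l) / 2 := by
    ext n
    simp only [Finset.sum_apply, Pi.smul_apply]
    simp only [map_sum, AddMonoidHom.finsetSum_apply, map_zsmul, AddMonoidHom.zsmul_apply,
      zsmul_eq_mul, Finset.sum_div, Finset.mul_sum]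
    rw [Finset.sum_comm]
    refine Finset.sum_congr rfl fun k _ => Finset.sum_congr rfl fun l _ => ?_
    ring
  have : (fun n => θ (∑ k, m k • a n k) (∑ k, m' k • a n k) / 2) ∈ S := by
    rw [h]
    exact sum_mem fun k _ => sum_mem fun l _ => zsmul_mem (zsmul_mem (hχ k l) _) _
  exact this

namespace HasAsympSymbol

lemma of_tendsto_coef {κ : Type} [Fintype κ] (hT : ∀ g, ‖T g‖ ≤ 1) {m : κ → ι → ℤ}
    {c : ℕ → κ → ℂ} {c₀ : κ → ℂ} (hc : ∀ s, Tendsto (fun n => c n s) atTop (𝓝 (c₀ s))) :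
    HasAsympSymbol T a (fun n => ∑ s, c n s • T (∑ k, m s k • a n k))
      (∑ s, c₀ s • UnitAddTorus.mFourier (m s)) := by
  refine ⟨κ, inferInstance, m, c₀, ?_, rfl⟩
  simp_rw [← Finset.sum_sub_distrib, ← sub_smul]
  rw [← Finset.sum_const_zero (s := (Finset.univ : Finset κ))]
  refine tendsto_finsetSum _ fun s _ => ?_
  have h1 : Tendsto (fun n => ‖c n s - c₀ s‖) atTop (𝓝 0) := by
    simpa using (tendsto_iff_norm_sub_tendsto_zero.1 (hc s))
  refine squeeze_zero_norm (fun n => ?_) h1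
  rw [norm_smul]
  exact mul_le_of_le_one_right (norm_nonneg _) (hT _)

lemma one (h0 : T 0 = 1) : HasAsympSymbol T a (fun _ => 1) 1 := by
  refine ⟨Unit, inferInstance, fun _ => 0, fun _ => 1, ?_, ?_⟩
  · simp [h0]
  · simp [UnitAddTorus.mFourier_zero]

lemma add (hx : HasAsympSymbol T a x φ) (hy : HasAsympSymbol T a y ψ) :
    HasAsympSymbol T a (fun n => x n + y n) (φ + ψ) := by
  obtain ⟨κ, _, m, c, h, rfl⟩ := hx
  obtain ⟨κ', _, m', c', h', rfl⟩ := hy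
  refine ⟨κ ⊕ κ', inferInstance, Sum.elim m m', Sum.elim c c', ?_, ?_⟩
  · have := h.add h'
    rw [add_zero] at this
    refine this.congr fun n => ?_
    rw [Fintype.sum_sum_type]
    simp only [Sum.elim_inl, Sum.elim_inr]
    abel
  · rw [Fintype.sum_sum_type]
    simp

lemma smul (r : ℂ) (hx : HasAsympSymbol T a x φ) :
    HasAsympSymbol T a (fun n => r • x n) (r • φ) := by
  obtain ⟨κ, _, m, c, h, rfl⟩ := hx
  refine ⟨κ, inferInstance, m, fun s => r * c s, ?_, ?_⟩
  · have := h.const_smul r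
    rw [smul_zero] at this
    refine this.congr fun n => ?_
    rw [smul_sub, Finset.smul_sum]
    simp_rw [smul_smul]
  · rw [Finset.smul_sum]
    simp_rw [smul_smul]

lemma star (hstar : ∀ x, star (T x) = T (-x)) (hx : HasAsympSymbol T a x φ) :
    HasAsympSymbol T a (fun n => star (x n)) (star φ) := by
  obtain ⟨κ, _, m, c, h, rfl⟩ := hx
  refine ⟨κ, inferInstance, fun s => -m s, fun s => starRingEnd ℂ (c s), ?_, ?_⟩
  · have := h.star
    rw [star_zero] at this
    refine this.congr fun n => ?_
    rw [star_sub, star_sum]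
    congr 1
    refine Finset.sum_congr rfl fun s _ => ?_
    rw [star_smul, hstar, ← Finset.sum_neg_distrib]
    simp [neg_smul]
  · rw [star_sum]
    refine Finset.sum_congr rfl fun s _ => ?_
    ext z
    simp [UnitAddTorus.mFourier_neg]

lemma exists_bound (hT : ∀ g, ‖T g‖ ≤ 1) (hx : HasAsympSymbol T a x φ) :
    ∃ M : ℝ, (∀ᶠ n in atTop, ‖x n‖ ≤ M) ∧ ∀ z, ‖φ z‖ ≤ M := by
  obtain ⟨κ, _, m, c, h, rfl⟩ := hx
  refine ⟨∑ s, ‖c s‖ + 1, ?_, fun z => ?_⟩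
  · have h1 := h.norm.eventually_lt_const (show ‖(0 : H →L[ℂ] H)‖ < 1 by simp)
    filter_upwards [h1] with n hn
    have h2 : ‖∑ s, c s • T (∑ k, m s k • a n k)‖ ≤ ∑ s, ‖c s‖ :=
      (norm_sum_le _ _).trans (Finset.sum_le_sum fun s _ => by
        rw [norm_smul]
        exact mul_le_of_le_one_right (norm_nonneg _) (hT _))
    have h3 := norm_add_le (x n - ∑ s, c s • T (∑ k, m s k • a n k))
      (∑ s, c s • T (∑ k, m s k • a n k))
    rw [sub_add_cancel] at h3
    linarith
  · rw [ContinuousMap.sum_apply]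
    refine ((norm_sum_le _ _).trans (Finset.sum_le_sum fun s _ => ?_)).trans (by linarith)
    rw [ContinuousMap.smul_apply, norm_smul]
    refine mul_le_of_le_one_right (norm_nonneg _) ?_
    have := (UnitAddTorus.mFourier (m s)).norm_coe_le_norm z
    rwa [UnitAddTorus.mFourier_norm] at this

lemma mul (hT : ∀ g, ‖T g‖ ≤ 1)
    (hmul : ∀ x y, T x * T y = expChar (θ x y / 2) • T (x + y))
    (hχ : ∀ k l, Tendsto (fun n => expChar (θ (a n k) (a n l) / 2)) atTop (𝓝 1))
    (hx : HasAsympSymbol T a x φ) (hy : HasAsympSymbol T a y ψ) :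
    HasAsympSymbol T a (fun n => x n * y n) (φ * ψ) := by
  obtain ⟨M, hM, -⟩ := hx.exists_bound hT
  obtain ⟨κ, _, m, c, h, rfl⟩ := hx
  obtain ⟨κ', _, m', c', h', rfl⟩ := hy
  refine ⟨κ × κ', inferInstance, fun p => m p.1 + m' p.2, fun p => c p.1 * c' p.2, ?_, ?_⟩
  · let P : ℕ → H →L[ℂ] H := fun n => ∑ s, c s • T (∑ k, m s k • a n k)
    let P' : ℕ → H →L[ℂ] H := fun n => ∑ s, c' s • T (∑ k, m' s k • a n k)
    let R : ℕ → H →L[ℂ] H := fun n =>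
      ∑ p : κ × κ', (c p.1 * c' p.2) • T (∑ k, (m p.1 + m' p.2) k • a n k)
    have hP' : ∀ n, ‖P' n‖ ≤ ∑ s, ‖c' s‖ := fun n =>
      (norm_sum_le _ _).trans (Finset.sum_le_sum fun s _ => by
        rw [norm_smul]
        exact mul_le_of_le_one_right (norm_nonneg _) (hT _))
    have e1 : Tendsto (fun n => x n * (y n - P' n)) atTop (𝓝 0) := by
      refine squeeze_zero_norm' (a := fun n => M * ‖y n - P' n‖) ?_ ?_
      · filter_upwards [hM] with n hn
        exact (norm_mul_le _ _).trans (by gcongr)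
      · have := h'.norm.const_mul M
        rwa [norm_zero, mul_zero] at this
    have e2 : Tendsto (fun n => (x n - P n) * P' n) atTop (𝓝 0) := by
      refine squeeze_zero_norm (a := fun n => ‖x n - P n‖ * ∑ s, ‖c' s‖) (fun n => ?_) ?_
      · exact (norm_mul_le _ _).trans (by gcongr; exact hP' n)
      · have := h.norm.mul_const (∑ s, ‖c' s‖)
        rwa [norm_zero, zero_mul] at this
    have e3 : Tendsto (fun n => P n * P' n - R n) atTop (𝓝 0) := by
      have hsum : ∀ n, P n * P' n - R n = ∑ p : κ × κ', ((c p.1 * c' p.2) *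
          (expChar (θ (∑ k, m p.1 k • a n k) (∑ k, m' p.2 k • a n k) / 2) - 1)) •
            T (∑ k, (m p.1 + m' p.2) k • a n k) := by
        intro n
        simp only [P, P', R]
        rw [Finset.sum_mul_sum, Fintype.sum_prod_type, Fintype.sum_prod_type,
          ← Finset.sum_sub_distrib]
        refine Finset.sum_congr rfl fun s _ => ?_
        rw [← Finset.sum_sub_distrib]
        refine Finset.sum_congr rfl fun s' _ => ?_
        have hadd : ∑ k, (m s + m' s') k • a n k = ∑ k, m s k • a n k + ∑ k, m' s' k • a n k := by
          simp [add_smul, Finset.sum_add_distrib]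
        rw [smul_mul_smul_comm, hmul, ← hadd, smul_smul, ← sub_smul]
        congr 1
        ring
      simp_rw [hsum]
      rw [show (0 : H →L[ℂ] H) = ∑ _p : κ × κ', 0 from Finset.sum_const_zero.symm]
      refine tendsto_finsetSum _ fun p _ => ?_
      have h1 := ((tendsto_expChar_sum hχ (m p.1) (m' p.2)).sub_const 1).const_mul
        (c p.1 * c' p.2)
      rw [sub_self, mul_zero] at h1
      have h2 := h1.norm
      rw [norm_zero] at h2
      refine squeeze_zero_norm (fun n => ?_) h2
      rw [norm_smul]
      exact mul_le_of_le_one_right (norm_nonneg _) (hT _)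
    have := (e1.add e2).add e3
    rw [add_zero, add_zero] at this
    refine this.congr fun n => ?_
    change _ = x n * y n - R n
    noncomm_ring
  · ext z
    simp only [ContinuousMap.mul_apply, ContinuousMap.sum_apply, ContinuousMap.smul_apply,
      UnitAddTorus.mFourier_add, Fintype.sum_prod_type, Finset.sum_mul_sum, smul_eq_mul]
    refine Finset.sum_congr rfl fun s _ => Finset.sum_congr rfl fun s' _ => ?_
    ring

end HasAsympSymbol

namespace HasAsympSymbol

lemma pow (hT : ∀ g, ‖T g‖ ≤ 1) (h0 : T 0 = 1)
    (hmul : ∀ x y, T x * T y = expChar (θ x y / 2) • T (x + y))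
    (hχ : ∀ k l, Tendsto (fun n => expChar (θ (a n k) (a n l) / 2)) atTop (𝓝 1))
    (hx : HasAsympSymbol T a x φ) (r : ℕ) : HasAsympSymbol T a (fun n => x n ^ r) (φ ^ r) := by
  induction r with
  | zero => simpa using one h0
  | succ r ih =>
    simp_rw [pow_succ]
    exact ih.mul hT hmul hχ hx

lemma aeval (hT : ∀ g, ‖T g‖ ≤ 1) (h0 : T 0 = 1)
    (hmul : ∀ x y, T x * T y = expChar (θ x y / 2) • T (x + y))
    (hχ : ∀ k l, Tendsto (fun n => expChar (θ (a n k) (a n l) / 2)) atTop (𝓝 1))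
    (hx : HasAsympSymbol T a x φ) (p : Polynomial ℝ) :
    HasAsympSymbol T a (fun n => Polynomial.aeval (x n) p) (Polynomial.aeval φ p) := by
  induction p using Polynomial.induction_on' with
  | add p q hp hq =>
    simp_rw [map_add]
    exact hp.add hq
  | monomial r c =>
    simp_rw [Polynomial.aeval_monomial, ← Algebra.smul_def, ← Complex.coe_smul]
    exact (hx.pow hT h0 hmul hχ r).smul (c : ℂ)

end HasAsympSymbol

lemma vecState_add (e₀ : H) (A B : H →L[ℂ] H) :
    vecState e₀ (A + B) = vecState e₀ A + vecState e₀ B := by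
  simp [vecState]

lemma vecState_sum_smul {κ : Type} (s : Finset κ) (c : κ → ℂ) (A : κ → H →L[ℂ] H) :
    vecState e₀ (∑ i ∈ s, c i • A i) = ∑ i ∈ s, c i * vecState e₀ (A i) := by
  simp [vecState]

lemma norm_vecState_le (h : ‖e₀‖ = 1) (A : H →L[ℂ] H) : ‖vecState e₀ A‖ ≤ ‖A‖ := by
  have h1 := norm_inner_le_norm (𝕜 := ℂ) e₀ (A e₀)
  have h2 := A.le_opNorm e₀
  rw [h, one_mul] at h1
  rw [h, mul_one] at h2
  exact h1.trans h2

lemma HasAsympSymbol.tendsto_vecState (he : ‖e₀‖ = 1) (h0 : T 0 = 1)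
    (hτ : ∀ g, g ≠ 0 → vecState e₀ (T g) = 0)
    (ha : ∀ m : ι → ℤ, m ≠ 0 → ∀ᶠ n in atTop, ∑ k, m k • a n k ≠ 0)
    (hx : HasAsympSymbol T a x φ) :
    Tendsto (fun n => vecState e₀ (x n)) atTop (𝓝 (∫ z, φ z ∂torusMeasure ι)) := by
  obtain ⟨κ, _, m, c, h, rfl⟩ := hx
  have h1 : Tendsto (fun n => vecState e₀ (x n - ∑ s, c s • T (∑ k, m s k • a n k))) atTop
      (𝓝 0) := by
    have h2 := h.norm
    rw [norm_zero] at h2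
    exact squeeze_zero_norm (fun n => norm_vecState_le he _) h2
  have h3 : ∫ z, (∑ s, c s • UnitAddTorus.mFourier (m s)) z ∂torusMeasure ι
      = ∑ s, c s * if m s = 0 then 1 else 0 := by
    simp_rw [ContinuousMap.sum_apply, ContinuousMap.smul_apply, smul_eq_mul]
    rw [integral_finsetSum _ fun s _ => integrable_torusMeasure (by fun_prop)]
    simp_rw [integral_const_mul, integral_mFourier]
  have h4 : ∀ᶠ n in atTop, ∀ s, vecState e₀ (T (∑ k, m s k • a n k)) = if m s = 0 then 1 else 0 :=
    eventually_all.2 fun s => by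
      by_cases hs : m s = 0
      · refine Eventually.of_forall fun n => ?_
        simp [hs, h0, vecState, he]
      · filter_upwards [ha (m s) hs] with n hn
        rw [if_neg hs, hτ _ hn]
  rw [h3, ← zero_add (∑ s, c s * _)]
  refine (h1.add (tendsto_const_nhds (x := ∑ s, c s * if m s = 0 then (1 : ℂ) else 0))).congr' ?_
  filter_upwards [h4] with n hn
  rw [← Finset.sum_congr rfl fun s _ => congrArg (c s * ·) (hn s), ← vecState_sum_smul,
    ← vecState_add, sub_add_cancel]

lemma norm_opAbs_sub_aeval_le {A : H →L[ℂ] H} {M ε : ℝ} (hA : ‖A‖ ≤ M) (hε : 0 ≤ ε)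
    {p : Polynomial ℝ} (hp : ∀ t ∈ Set.Icc 0 (M ^ 2), |p.eval t - √t| ≤ ε) :
    ‖opAbs A - Polynomial.aeval (star A * A) p‖ ≤ ε := by
  have hb : 0 ≤ star A * A := star_mul_self_nonneg A
  have hsa : IsSelfAdjoint (star A * A) := .star_mul_self A
  have hn : ‖star A * A‖ ≤ M ^ 2 := by
    rw [CStarRing.norm_star_mul_self, pow_two]
    exact mul_self_le_mul_self (norm_nonneg _) hA
  have h1 : opAbs A = cfc Real.sqrt (star A * A) := by
    rw [opAbs, CFC.sqrt_eq_real_sqrt _ hb, cfcₙ_eq_cfc]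
  rw [h1, ← cfc_polynomial p (star A * A), ← cfc_sub _ _ _]
  refine norm_cfc_le hε fun t ht => ?_
  have h2 : 0 ≤ t := spectrum_nonneg_of_nonneg hb ht
  have h3 : ‖t‖ ≤ ‖star A * A‖ := by
    have := spectrum.norm_le_norm_mul_of_mem ht
    refine this.trans (mul_le_of_le_one_right (norm_nonneg _) ContinuousLinearMap.norm_id_le)
  rw [Real.norm_of_nonneg h2] at h3
  rw [Real.norm_eq_abs, abs_sub_comm]
  exact hp t ⟨h2, h3.trans hn⟩

lemma HasAsympSymbol.tendsto_l1Norm (hθ : ∀ x y, θ x y = -θ y x) (he : ‖e₀‖ = 1) (h0 : T 0 = 1)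
    (hmul : ∀ x y, T x * T y = expChar (θ x y / 2) • T (x + y))
    (hstar : ∀ x, Star.star (T x) = T (-x)) (hτ : ∀ g, g ≠ 0 → vecState e₀ (T g) = 0)
    (hχ : ∀ k l, Tendsto (fun n => expChar (θ (a n k) (a n l) / 2)) atTop (𝓝 1))
    (ha : ∀ m : ι → ℤ, m ≠ 0 → ∀ᶠ n in atTop, ∑ k, m k • a n k ≠ 0)
    (hx : HasAsympSymbol T a x φ) :
    Tendsto (fun n => l1Norm e₀ (x n)) atTop (𝓝 (∫ z, ‖φ z‖ ∂torusMeasure ι)) := by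
  have hT := norm_twisted_le hθ h0 hmul hstar
  obtain ⟨M, hM, hφ⟩ := hx.exists_bound hT
  refine Metric.tendsto_atTop'.2 fun ε hε => ?_
  obtain ⟨p, hp⟩ := exists_polynomial_near_of_continuousOn 0 (M ^ 2) Real.sqrt
    Real.continuous_sqrt.continuousOn (ε / 3) (by positivity)
  have hp' : ∀ t ∈ Set.Icc 0 (M ^ 2), |p.eval t - √t| ≤ ε / 3 := fun t ht => (hp t ht).le
  have hb := ((hx.star hstar).mul hT hmul hχ hx).aeval hT h0 hmul hχ p
  have hsym : ∀ z, Polynomial.aeval (Star.star φ * φ) p z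
      = ((p.eval (‖φ z‖ ^ 2) : ℝ) : ℂ) := fun z => by
    have h1 : Polynomial.aeval (Star.star φ * φ) p z = Polynomial.aeval ((Star.star φ * φ) z) p :=
      (Polynomial.aeval_algHom_apply (ContinuousMap.evalAlgHom ℝ ℂ z) (Star.star φ * φ) p).symm
    rw [h1]
    have h2 : (Star.star φ * φ) z = algebraMap ℝ ℂ (‖φ z‖ ^ 2) := by
      have := Complex.conj_mul' (φ z)
      simpa using this
    rw [h2, Polynomial.aeval_algebraMap_apply]
    rfl
  have hlim := hb.tendsto_vecState he h0 hτ ha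
  simp_rw [hsym] at hlim
  rw [integral_complex_ofReal] at hlim
  have hlim' := (Complex.continuous_re.tendsto _).comp hlim
  rw [Complex.ofReal_re] at hlim'
  have hI : |∫ z, p.eval (‖φ z‖ ^ 2) ∂torusMeasure ι - ∫ z, ‖φ z‖ ∂torusMeasure ι| ≤ ε / 3 := by
    rw [← integral_sub (integrable_torusMeasure (by fun_prop))
        (integrable_torusMeasure (by fun_prop)),
      ← Real.norm_eq_abs]
    have := norm_integral_le_of_norm_le_const (μ := torusMeasure ι) (C := ε / 3)
      (f := fun z => p.eval (‖φ z‖ ^ 2) - ‖φ z‖) (Eventually.of_forall fun z => by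
        have := hp' (‖φ z‖ ^ 2) ⟨by positivity, by gcongr; exact hφ z⟩
        rwa [Real.sqrt_sq (norm_nonneg _)] at this)
    simpa using this
  obtain ⟨N, hN⟩ := eventually_atTop.1
    (hM.and (Metric.tendsto_nhds.1 hlim' (ε / 3) (by positivity)))
  refine ⟨N, fun n hn => ?_⟩
  obtain ⟨h1, h2⟩ := hN n hn.le
  rw [Function.comp_apply, Real.dist_eq] at h2
  have h3 := (norm_vecState_le he _).trans
    (norm_opAbs_sub_aeval_le h1 (by positivity : 0 ≤ ε / 3) hp')
  have h4 : vecState e₀ (opAbs (x n)) = vecState e₀ (opAbs (x n) -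
      Polynomial.aeval (Star.star (x n) * x n) p) +
      vecState e₀ (Polynomial.aeval (Star.star (x n) * x n) p) := by
    rw [← vecState_add, sub_add_cancel]
  have h5 := (Complex.abs_re_le_norm _).trans h3
  rw [Real.dist_eq, l1Norm, h4, Complex.add_re]
  rw [abs_le] at hI h5
  rw [abs_lt] at h2 ⊢
  constructor <;> linarith

end Transference

section Frequencies

lemma norm_expChar_add_sub_one_le (x y : ℝ) :
    ‖expChar (x + y) - 1‖ ≤ ‖expChar x - 1‖ + ‖expChar y - 1‖ := by
  have h : expChar (x + y) - 1 = (expChar x - 1) * expChar y + (expChar y - 1) := by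
    rw [expChar_add]
    ring
  rw [h]
  refine (norm_add_le _ _).trans ?_
  rw [norm_mul, norm_expChar, mul_one]

lemma norm_expChar_sum_sub_one_le {κ : Type} (s : Finset κ) (x : κ → ℝ) :
    ‖expChar (∑ i ∈ s, x i) - 1‖ ≤ ∑ i ∈ s, ‖expChar (x i) - 1‖ := by
  classical
  induction s using Finset.induction_on with
  | empty => simp [expChar_zero]
  | insert i s hi ih =>
    rw [Finset.sum_insert hi, Finset.sum_insert hi]
    exact (norm_expChar_add_sub_one_le _ _).trans (by gcongr)

lemma norm_expChar_neg_sub_one (x : ℝ) : ‖expChar (-x) - 1‖ = ‖expChar x - 1‖ := by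
  have h : expChar (-x) * (expChar x - 1) = -(expChar (-x) - 1) := by
    rw [mul_sub, ← expChar_add, neg_add_cancel, expChar_zero]
    ring
  have := congrArg norm h
  rw [norm_mul, norm_expChar, one_mul, norm_neg] at this
  exact this.symm

/-- The common almost periods of finitely many characters of `ℤ` are relatively dense. -/
lemma exists_almost_period {κ : Type} [Fintype κ] (x : κ → ℝ) {δ : ℝ} (hδ : 0 < δ) :
    ∃ L : ℕ, ∀ X : ℕ, ∃ m : ℕ, X ≤ m ∧ m ≤ X + L ∧ ∀ i, ‖expChar (m * x i) - 1‖ ≤ δ := by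
  let v : ℕ → κ → ℂ := fun n i => expChar (n * x i)
  have hb : TotallyBounded (Set.range v) := by
    refine (isCompact_closedBall (0 : κ → ℂ) 1).totallyBounded.subset ?_
    rintro _ ⟨n, rfl⟩
    rw [mem_closedBall_zero_iff, pi_norm_le_iff_of_nonneg zero_le_one]
    exact fun i => (norm_expChar _).le
  obtain ⟨t, ht, htf, hc⟩ := Metric.finite_approx_of_totallyBounded hb δ hδ
  have ht' : ∀ y ∈ t, ∃ n, v n = y := ht
  choose! g hg using ht'
  obtain ⟨L, hL⟩ := (htf.image g).bddAbove
  refine ⟨L, fun X => ?_⟩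
  obtain ⟨y, hy, hd⟩ := Set.mem_iUnion₂.1 (hc ⟨X + L, rfl⟩)
  have hgL : g y ≤ L := hL ⟨y, hy, rfl⟩
  refine ⟨X + L - g y, by omega, by omega, fun i => ?_⟩
  have h1 : expChar ((X + L : ℕ) * x i) - expChar (g y * x i)
      = expChar (g y * x i) * (expChar ((X + L - g y : ℕ) * x i) - 1) := by
    rw [mul_sub, ← expChar_add, mul_one, ← add_mul, ← Nat.cast_add, Nat.add_sub_cancel' (by omega)]
  have h2 := (dist_le_pi_dist (v (X + L)) y i).trans (Metric.mem_ball.1 hd).le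
  rw [← hg y hy, dist_eq_norm] at h2
  change ‖expChar ((X + L : ℕ) * x i) - expChar (g y * x i)‖ ≤ δ at h2
  rwa [h1, norm_mul, norm_expChar, one_mul] at h2

variable {d : ℕ} {ι : Type} [Fintype ι]

lemma matrixForm_eq_sum (Θ : Matrix (Fin d) (Fin d) ℝ) (x y : Fin d → ℤ) :
    matrixForm Θ x y / 2 = ∑ i, x i * (∑ j, Θ i j * y j / 2) := by
  rw [matrixForm_apply, Finset.sum_div]
  refine Finset.sum_congr rfl fun i _ => ?_
  rw [Finset.sum_div, Finset.mul_sum]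
  refine Finset.sum_congr rfl fun j _ => ?_
  ring

/-- A vector of prescribed size which almost commutes with given vectors and dominates them. -/
lemma exists_next_frequency (Θ : Matrix (Fin d) (Fin d) ℝ) {Λ : Fin d → ℕ} (hΛ : ∀ i, 1 ≤ Λ i)
    (μ : Fin d → ℕ) {t : ℕ} (ht : 1 ≤ t) (b : ι → Fin d → ℤ) {δ : ℝ} (hδ : 0 < δ) :
    ∃ (v : Fin d → ℤ) (R : ℕ), 1 ≤ R ∧
      (∀ i, |(v i : ℝ) - t ^ μ i * R ^ Λ i| ≤ δ * (t ^ μ i * R ^ Λ i)) ∧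
      (∀ l i, |(b l i : ℝ)| ≤ δ * (t ^ μ i * R ^ Λ i)) ∧
      ∀ l, ‖expChar (matrixForm Θ v (b l) / 2) - 1‖ ≤ δ := by
  obtain ⟨L, hL⟩ := exists_almost_period
    (fun p : ι × Fin d => ∑ j, Θ p.2 j * b p.1 j / 2) (δ := δ / (d + 1)) (by positivity)
  obtain ⟨R, hR⟩ := exists_nat_ge ((L + ∑ l, ∑ i, |(b l i : ℝ)|) / δ + 1)
  have hS : 0 ≤ ∑ l, ∑ i, |(b l i : ℝ)| :=
    Finset.sum_nonneg fun l _ => Finset.sum_nonneg fun i _ => abs_nonneg _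
  have hR1 : (1 : ℝ) ≤ R := by
    have : 0 ≤ (L + ∑ l, ∑ i, |(b l i : ℝ)|) / δ := by positivity
    linarith
  have hRle : ∀ i, (R : ℝ) ≤ t ^ μ i * R ^ Λ i := fun i => by
    have h1 : (1 : ℝ) ≤ (t : ℝ) ^ μ i := one_le_pow₀ (by exact_mod_cast ht)
    have h2 : (R : ℝ) ≤ (R : ℝ) ^ Λ i := le_self_pow₀ hR1 (by have := hΛ i; omega)
    nlinarith
  have hsize : ∀ i, L + ∑ l, ∑ i, |(b l i : ℝ)| ≤ δ * (t ^ μ i * R ^ Λ i) := fun i => by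
    have h1 : (L + ∑ l, ∑ i, |(b l i : ℝ)|) / δ ≤ R := by linarith
    rw [div_le_iff₀ hδ, mul_comm] at h1
    exact h1.trans (mul_le_mul_of_nonneg_left (hRle i) hδ.le)
  choose m hm1 hm2 hm3 using fun i => hL (t ^ μ i * R ^ Λ i)
  refine ⟨fun i => m i, R, by exact_mod_cast hR1, fun i => ?_, fun l i => ?_, fun l => ?_⟩
  · have h1 : ((t ^ μ i * R ^ Λ i : ℕ) : ℝ) ≤ m i := by exact_mod_cast hm1 i
    have h2 : (m i : ℝ) ≤ (t ^ μ i * R ^ Λ i : ℕ) + L := by exact_mod_cast hm2 i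
    push_cast at h1 h2 ⊢
    rw [abs_of_nonneg (by linarith)]
    linarith [hsize i]
  · have h1 : |(b l i : ℝ)| ≤ ∑ l, ∑ i, |(b l i : ℝ)| :=
      (Finset.single_le_sum (f := fun i => |(b l i : ℝ)|) (fun i _ => abs_nonneg _)
        (Finset.mem_univ i)).trans
        (Finset.single_le_sum (f := fun l => ∑ i, |(b l i : ℝ)|)
          (fun l _ => Finset.sum_nonneg fun i _ => abs_nonneg _) (Finset.mem_univ l))
    linarith [hsize i, (Nat.cast_nonneg L : (0 : ℝ) ≤ L)]
  · rw [matrixForm_eq_sum]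
    refine (norm_expChar_sum_sub_one_le _ _).trans ?_
    refine (Finset.sum_le_sum fun i _ => ?_).trans (b := ∑ _i : Fin d, δ / (d + 1)) ?_
    · have := hm3 i (l, i)
      simpa using this
    · rw [Finset.sum_const, Finset.card_univ, Fintype.card_fin, nsmul_eq_mul, mul_div_assoc',
        div_le_iff₀ (by positivity)]
      nlinarith

lemma exists_frequencies_of_pos (Θ : Matrix (Fin d) (Fin d) ℝ) (hΘ : Matrix.transpose Θ = -Θ)
    {Λ : Fin d → ℕ} (hΛ : ∀ i, 1 ≤ Λ i) (μ : Fin d → ℕ) {rank : ι → ℕ}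
    (hrank : Function.Injective rank) {t : ι → ℕ} (ht : ∀ k, 1 ≤ t k) {δ : ℝ} (hδ : 0 < δ) :
    ∃ (a : ι → Fin d → ℤ) (R : ι → ℕ), (∀ k, 1 ≤ R k) ∧
      (∀ k i, |(a k i : ℝ) - t k ^ μ i * R k ^ Λ i| ≤ δ * (t k ^ μ i * R k ^ Λ i)) ∧
      (∀ k l, rank l < rank k → ∀ i, |(a l i : ℝ)| ≤ δ * (t k ^ μ i * R k ^ Λ i)) ∧
      ∀ k l, ‖expChar (matrixForm Θ (a k) (a l) / 2) - 1‖ ≤ δ := by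
  classical
  have key : ∀ s : Finset ι, ∃ (a : ι → Fin d → ℤ) (R : ι → ℕ), (∀ k ∈ s, 1 ≤ R k) ∧
      (∀ k ∈ s, ∀ i, |(a k i : ℝ) - t k ^ μ i * R k ^ Λ i| ≤ δ * (t k ^ μ i * R k ^ Λ i)) ∧
      (∀ k ∈ s, ∀ l ∈ s, rank l < rank k →
        ∀ i, |(a l i : ℝ)| ≤ δ * (t k ^ μ i * R k ^ Λ i)) ∧
      ∀ k ∈ s, ∀ l ∈ s, rank l < rank k →
        ‖expChar (matrixForm Θ (a k) (a l) / 2) - 1‖ ≤ δ := by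
    intro s
    induction s using Finset.induction_on_max_value rank with
    | empty => exact ⟨fun _ => 0, fun _ => 0, by simp⟩
    | insert k₀ s hk₀ hmax ih =>
      obtain ⟨a, R, h1, h2, h3, h4⟩ := ih
      obtain ⟨v, r, hr, hv, hb, hc⟩ := exists_next_frequency Θ hΛ μ (ht k₀) a hδ
      have hne : ∀ k ∈ s, k ≠ k₀ := fun k hk h => hk₀ (h ▸ hk)
      refine ⟨Function.update a k₀ v, Function.update R k₀ r, fun k hk => ?_, fun k hk => ?_,
        fun k hk l hl hlk => ?_, fun k hk l hl hlk => ?_⟩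
      · rcases Finset.mem_insert.1 hk with rfl | hk
        · simpa using hr
        · simpa [hne k hk] using h1 k hk
      · rcases Finset.mem_insert.1 hk with rfl | hk
        · simpa using hv
        · simpa [hne k hk] using h2 k hk
      · rcases Finset.mem_insert.1 hk with rfl | hk' <;>
          rcases Finset.mem_insert.1 hl with rfl | hl'
        · exact absurd hlk (lt_irrefl _)
        · simpa [hne l hl'] using hb l
        · exact absurd (hmax k hk') (not_le.2 hlk)
        · simpa [hne k hk', hne l hl'] using h3 k hk' l hl' hlk
      · rcases Finset.mem_insert.1 hk with rfl | hk' <;>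
          rcases Finset.mem_insert.1 hl with rfl | hl'
        · exact absurd hlk (lt_irrefl _)
        · simpa [hne l hl'] using hc l
        · exact absurd (hmax k hk') (not_le.2 hlk)
        · simpa [hne k hk', hne l hl'] using h4 k hk' l hl' hlk
  obtain ⟨a, R, h1, h2, h3, h4⟩ := key Finset.univ
  refine ⟨a, R, fun k => h1 k (Finset.mem_univ k), fun k => h2 k (Finset.mem_univ k),
    fun k l => h3 k (Finset.mem_univ k) l (Finset.mem_univ l), fun k l => ?_⟩
  rcases lt_trichotomy (rank l) (rank k) with h | h | h
  · exact h4 k (Finset.mem_univ k) l (Finset.mem_univ l) h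
  · have h5 : matrixForm Θ (a k) (a k) = 0 := by linarith [matrixForm_skew hΘ (a k) (a k)]
    rw [hrank h, h5, zero_div, expChar_zero, sub_self, norm_zero]
    exact hδ.le
  · rw [matrixForm_skew hΘ, neg_div, norm_expChar_neg_sub_one]
    exact h4 l (Finset.mem_univ l) k (Finset.mem_univ k) h

lemma exists_frequencies (Θ : Matrix (Fin d) (Fin d) ℝ) (hΘ : Matrix.transpose Θ = -Θ)
    {Λ : Fin d → ℕ} (hΛ : ∀ i, 1 ≤ Λ i) (μ : Fin d → ℕ) {rank : ι → ℕ}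
    (hrank : Function.Injective rank) {t : ι → ℕ} (ht : ∀ k, 1 ≤ t k) :
    ∃ (a : ℕ → ι → Fin d → ℤ) (R : ℕ → ι → ℕ), (∀ n k, 1 ≤ R n k) ∧
      (∀ k i, Tendsto (fun n => (a n k i : ℝ) / (t k ^ μ i * R n k ^ Λ i)) atTop (𝓝 1)) ∧
      (∀ k l, rank l < rank k → ∀ i,
        Tendsto (fun n => (a n l i : ℝ) / (t k ^ μ i * R n k ^ Λ i)) atTop (𝓝 0)) ∧
      ∀ k l, Tendsto (fun n => expChar (matrixForm Θ (a n k) (a n l) / 2)) atTop (𝓝 1) := by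
  choose a R h1 h2 h3 h4 using fun n : ℕ => exists_frequencies_of_pos Θ hΘ hΛ μ hrank ht
    (Nat.one_div_pos_of_nat (α := ℝ) (n := n))
  have hpos : ∀ n k i, (0 : ℝ) < t k ^ μ i * R n k ^ Λ i := fun n k i => by
    have h5 := ht k
    have h6 := h1 n k
    positivity
  have hlim := tendsto_one_div_add_atTop_nhds_zero_nat (𝕜 := ℝ)
  refine ⟨a, R, h1, fun k i => ?_, fun k l hkl i => ?_, fun k l => ?_⟩
  · refine tendsto_iff_norm_sub_tendsto_zero.2 (squeeze_zero (fun n => norm_nonneg _)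
      (fun n => ?_) hlim)
    rw [div_sub_one (hpos n k i).ne', norm_div, Real.norm_eq_abs,
      Real.norm_of_nonneg (hpos n k i).le, div_le_iff₀ (hpos n k i)]
    exact h2 n k i
  · refine squeeze_zero_norm (fun n => ?_) hlim
    rw [norm_div, Real.norm_eq_abs, Real.norm_of_nonneg (hpos n k i).le, div_le_iff₀ (hpos n k i)]
    exact h3 n k l hkl i
  · exact tendsto_iff_norm_sub_tendsto_zero.2 (squeeze_zero (fun n => norm_nonneg _)
      (fun n => h4 n k l) hlim)

variable {Λ μ : Fin d → ℕ} {rank : ι → ℕ} {t : ι → ℕ} {a : ℕ → ι → Fin d → ℤ} {R : ℕ → ι → ℕ}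

lemma tendsto_frequency_div (hrank : Function.Injective rank)
    (h1 : ∀ k i, Tendsto (fun n => (a n k i : ℝ) / (t k ^ μ i * R n k ^ Λ i)) atTop (𝓝 1))
    (h2 : ∀ k l, rank l < rank k → ∀ i,
      Tendsto (fun n => (a n l i : ℝ) / (t k ^ μ i * R n k ^ Λ i)) atTop (𝓝 0))
    {m : ι → ℤ} {k : ι} (hm : ∀ l, rank k < rank l → m l = 0) (i : Fin d) :
    Tendsto (fun n => (((∑ l, m l • a n l) i : ℤ) : ℝ) / (t k ^ μ i * R n k ^ Λ i)) atTop
      (𝓝 (m k)) := by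
  classical
  have h : ∀ l, Tendsto (fun n => (m l : ℝ) * ((a n l i : ℝ) / (t k ^ μ i * R n k ^ Λ i))) atTop
      (𝓝 (if l = k then (m k : ℝ) else 0)) := fun l => by
    rcases lt_trichotomy (rank l) (rank k) with hl | hl | hl
    · rw [if_neg (fun h => by simp [h] at hl)]
      simpa using (h2 k l hl i).const_mul (m l : ℝ)
    · rw [if_pos (hrank hl), hrank hl]
      simpa using (h1 k i).const_mul (m k : ℝ)
    · rw [if_neg (fun h => by simp [h] at hl), hm l hl]
      simp
  have h3 := tendsto_finsetSum Finset.univ fun l _ => h l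
  rw [Finset.sum_ite_eq' Finset.univ k, if_pos (Finset.mem_univ k)] at h3
  refine h3.congr fun n => ?_
  simp only [Finset.sum_apply, Pi.smul_apply, smul_eq_mul]
  push_cast
  rw [Finset.sum_div]
  exact Finset.sum_congr rfl fun l _ => (mul_div_assoc _ _ _).symm

lemma eventually_frequency_ne_zero (hd : 0 < d) (hrank : Function.Injective rank)
    (h1 : ∀ k i, Tendsto (fun n => (a n k i : ℝ) / (t k ^ μ i * R n k ^ Λ i)) atTop (𝓝 1))
    (h2 : ∀ k l, rank l < rank k → ∀ i,
      Tendsto (fun n => (a n l i : ℝ) / (t k ^ μ i * R n k ^ Λ i)) atTop (𝓝 0))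
    {m : ι → ℤ} (hm : m ≠ 0) : ∀ᶠ n in atTop, ∑ k, m k • a n k ≠ 0 := by
  classical
  obtain ⟨k₁, hk₁⟩ := Function.ne_iff.1 hm
  obtain ⟨k, hk, hmax⟩ := Finset.exists_max_image (Finset.univ.filter fun k => m k ≠ 0) rank
    ⟨k₁, by simpa using hk₁⟩
  have hk' : (m k : ℝ) ≠ 0 := by simpa using hk
  have h3 := tendsto_frequency_div hrank h1 h2 (m := m) (k := k) (fun l hl => by
    by_contra h
    exact absurd (hmax l (by simpa using h)) (not_le.2 hl)) ⟨0, hd⟩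
  filter_upwards [h3.eventually_ne hk'] with n hn h
  rw [h] at hn
  simp at hn

lemma tendsto_derivative_coef (hrank : Function.Injective rank) (ht : ∀ k, 1 ≤ t k)
    (hR : ∀ n k, 1 ≤ R n k)
    (h1 : ∀ k i, Tendsto (fun n => (a n k i : ℝ) / (t k ^ μ i * R n k ^ Λ i)) atTop (𝓝 1))
    (h2 : ∀ k l, rank l < rank k → ∀ i,
      Tendsto (fun n => (a n l i : ℝ) / (t k ^ μ i * R n k ^ Λ i)) atTop (𝓝 0))
    {m : ι → ℤ} {k : ι} (hm : ∀ l, rank k < rank l → m l = 0) (α : Fin d → ℕ) :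
    Tendsto (fun n => (∏ i, (2 * (π : ℂ) * Complex.I * (((∑ l, m l • a n l) i : ℤ) : ℂ)) ^ α i)
        * ((R n k : ℂ) ^ ∑ i, α i * Λ i)⁻¹) atTop
      (𝓝 ((2 * (π : ℂ) * Complex.I * (m k : ℂ)) ^ (∑ i, α i) * (t k : ℂ) ^ ∑ i, α i * μ i)) := by
  have hpos : ∀ n i, (t k : ℂ) ^ μ i * (R n k : ℂ) ^ Λ i ≠ 0 := fun n i => by
    have h5 : t k ≠ 0 := by have := ht k; omega
    have h6 : R n k ≠ 0 := by have := hR n k; omega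
    exact mul_ne_zero (pow_ne_zero _ (by exact_mod_cast h5)) (pow_ne_zero _ (by exact_mod_cast h6))
  have h3 : Tendsto (fun n => ∏ i, (2 * (π : ℂ) * Complex.I * (t k : ℂ) ^ μ i *
      (((((∑ l, m l • a n l) i : ℤ) : ℝ) / (t k ^ μ i * R n k ^ Λ i) : ℝ) : ℂ)) ^ α i) atTop
      (𝓝 (∏ i, (2 * (π : ℂ) * Complex.I * (t k : ℂ) ^ μ i * ((m k : ℝ) : ℂ)) ^ α i)) :=
    tendsto_finsetProd _ fun i _ => (((Complex.continuous_ofReal.tendsto _).comp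
      (tendsto_frequency_div hrank h1 h2 hm i)).const_mul _).pow _
  have h4 : ∏ i, (2 * (π : ℂ) * Complex.I * (t k : ℂ) ^ μ i * ((m k : ℝ) : ℂ)) ^ α i
      = (2 * (π : ℂ) * Complex.I * (m k : ℂ)) ^ (∑ i, α i) * (t k : ℂ) ^ ∑ i, α i * μ i := by
    rw [← Finset.prod_pow_eq_pow_sum, ← Finset.prod_pow_eq_pow_sum, ← Finset.prod_mul_distrib]
    refine Finset.prod_congr rfl fun i _ => ?_
    push_cast
    ring
  rw [h4] at h3
  refine h3.congr fun n => ?_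
  rw [← Finset.prod_pow_eq_pow_sum, ← Finset.prod_inv_distrib, ← Finset.prod_mul_distrib]
  refine Finset.prod_congr rfl fun i _ => ?_
  have h5 := hpos n i
  have h6 := left_ne_zero_of_mul h5
  have h7 := right_ne_zero_of_mul h5
  rw [mul_comm (α i), pow_mul, ← inv_pow, ← mul_pow]
  congr 1
  push_cast
  field_simp

end Frequencies

section Realization

variable {d : ℕ} {Θ : Matrix (Fin d) (Fin d) ℝ} {T : (Fin d → ℤ) → H →L[ℂ] H} {e₀ : H}

/-- The twisted translations are unitary operators. -/
lemma twisted_mem_unitary (hΘ : Matrix.transpose Θ = -Θ) (h0 : T 0 = 1)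
    (hmul : ∀ x y, T x * T y = expChar (matrixForm Θ x y / 2) • T (x + y))
    (hstar : ∀ x, star (T x) = T (-x)) (x : Fin d → ℤ) : T x ∈ unitary (H →L[ℂ] H) := by
  have h : matrixForm Θ x x = 0 := by linarith [matrixForm_skew hΘ x x]
  rw [Unitary.mem_iff, hstar, hmul, hmul, neg_add_cancel, add_neg_cancel, h0, map_neg, map_neg,
    AddMonoidHom.neg_apply, h]
  simp [expChar_zero]

lemma twisted_mul_comm (hΘ : Matrix.transpose Θ = -Θ)
    (hmul : ∀ x y, T x * T y = expChar (matrixForm Θ x y / 2) • T (x + y)) (x y : Fin d → ℤ) :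
    T x * T y = expChar (matrixForm Θ x y) • (T y * T x) := by
  rw [hmul, hmul, smul_smul, ← expChar_add, add_comm y x, matrixForm_skew hΘ y x]
  congr 2
  ring

/-- The `L¹` norms of a wave configuration are limits of those of homogeneous derivatives of
polynomials in the generators of the quantum torus. -/
lemma WaveConfig.exists_tendsto_l1Norm (X : WaveConfig) (hd : 0 < d)
    (hΘ : Matrix.transpose Θ = -Θ) (he : ‖e₀‖ = 1) (h0 : T 0 = 1)
    (hmul : ∀ x y, T x * T y = expChar (matrixForm Θ x y / 2) • T (x + y))
    (hstar : ∀ x, star (T x) = T (-x)) (hτ : ∀ x, x ≠ 0 → vecState e₀ (T x) = 0)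
    {U : Fin d → unitary (H →L[ℂ] H)} (hU : ∀ k, (U k : H →L[ℂ] H) = T (Pi.single k 1))
    {Λ : Fin d → ℕ} (hΛ : ∀ i, 1 ≤ Λ i) (μ : Fin d → ℕ) (D : ℕ) :
    ∃ c : ℕ → (Fin d → ℤ) →₀ ℂ, ∀ α : Fin d → ℕ, ∑ i, α i * Λ i = D →
      Tendsto (fun n => l1Norm e₀ (derivPolyD U (c n) α)) atTop
        (𝓝 (X.nrm (∑ i, α i, ∑ i, α i * μ i))) := by
  obtain ⟨a, R, hR, h1, h2, h3⟩ := exists_frequencies Θ hΘ hΛ μ X.rank_injective X.one_le_scale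
  choose ω hω hωU using exists_qMonoD_eq hΘ h0 hmul hstar hU
  let γ : ℕ → X.κ → Fin d → ℤ := fun n s => ∑ k, X.freq s k • a n k
  refine ⟨fun n => ∑ s, Finsupp.single (γ n s)
    (X.coef s * ((R n (X.top s) : ℂ) ^ D)⁻¹ * (ω (γ n s))⁻¹), fun α hα => ?_⟩
  subst hα
  have hc : ∀ s, Tendsto (fun n => X.coef s *
      ((∏ i, (2 * (π : ℂ) * Complex.I * ((γ n s i : ℤ) : ℂ)) ^ α i)
        * ((R n (X.top s) : ℂ) ^ ∑ i, α i * Λ i)⁻¹)) atTop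
      (𝓝 (X.coef s * X.sym (∑ i, α i, ∑ i, α i * μ i) s)) := fun s =>
    (tendsto_derivative_coef X.rank_injective X.one_le_scale hR h1 h2
      (X.freq_above s) α).const_mul _
  have hx := (HasAsympSymbol.of_tendsto_coef (a := a) (m := X.freq)
    (norm_twisted_le (matrixForm_skew hΘ) h0 hmul hstar) hc).tendsto_l1Norm (matrixForm_skew hΘ)
      he h0 hmul hstar hτ h3 fun m hm => eventually_frequency_ne_zero hd X.rank_injective h1 h2 hm
  have hφ : X.nrm (∑ i, α i, ∑ i, α i * μ i) = ∫ z, ‖(∑ s, (X.coef s *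
      X.sym (∑ i, α i, ∑ i, α i * μ i) s) • UnitAddTorus.mFourier (X.freq s)) z‖
        ∂torusMeasure X.ι := by
    refine integral_congr_ae (Eventually.of_forall fun z => ?_)
    simp only [WaveConfig.fn, ContinuousMap.sum_apply, ContinuousMap.smul_apply, smul_eq_mul]
  rw [hφ]
  refine hx.congr fun n => ?_
  rw [derivPolyD_sum_single]
  congr 1
  refine Finset.sum_congr rfl fun s _ => ?_
  have h4 : ω (γ n s) ≠ 0 := fun h => by simpa [h] using hω (γ n s)
  rw [hωU, smul_smul]
  congr 1
  field_simp

end Realization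

lemma sum_mul_pow_injOn {d B : ℕ} {α β : Fin d → ℕ} (hα : ∀ i, α i < B) (hβ : ∀ i, β i < B)
    (h : ∑ i, α i * B ^ (i : ℕ) = ∑ i, β i * B ^ (i : ℕ)) : α = β := by
  have h1 : (finFunctionFinEquiv fun i => (⟨α i, hα i⟩ : Fin B))
      = finFunctionFinEquiv fun i => (⟨β i, hβ i⟩ : Fin B) := by
    refine Fin.ext ?_
    rw [finFunctionFinEquiv_apply, finFunctionFinEquiv_apply]
    exact h
  funext i
  have h2 := congrFun (finFunctionFinEquiv.injective h1) i
  simpa using h2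

/-- A multi-index is not dominated by finitely many others, quantitatively. -/
lemma WaveConfig.exists_sum_nrm_lt {n d : ℕ} (α : Fin n → Fin d → ℕ) (β : Fin d → ℕ)
    (hne : ∀ j, α j ≠ β) {K : ℝ} (hK : 0 ≤ K) : ∃ (μ : Fin d → ℕ) (X : WaveConfig),
      ∑ j, X.nrm (∑ i, α j i, ∑ i, α j i * μ i) < 1 ∧
      K < X.nrm (∑ i, β i, ∑ i, β i * μ i) := by
  classical
  let B : ℕ := ∑ i, β i + ∑ j, ∑ i, α j i + 1
  have hβB : ∀ i, β i < B := fun i => by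
    have := Finset.single_le_sum (f := β) (fun _ _ => Nat.zero_le _) (Finset.mem_univ i)
    omega
  have hαB : ∀ j i, α j i < B := fun j i => by
    have h1 := Finset.single_le_sum (f := α j) (fun _ _ => Nat.zero_le _) (Finset.mem_univ i)
    have h2 := Finset.single_le_sum (f := fun j => ∑ i, α j i) (fun _ _ => Nat.zero_le _)
      (Finset.mem_univ j)
    omega
  let e : (Fin d → ℕ) → ℕ × ℕ := fun δ => (∑ i, δ i, ∑ i, δ i * B ^ (i : ℕ))
  obtain ⟨X, hX⟩ := not_dominated (Finset.univ.image fun j => e (α j)) (e β)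
    (fun x hx y hy hxy => by
      obtain ⟨j, -, rfl⟩ := Finset.mem_image.1 hx
      obtain ⟨l, -, rfl⟩ := Finset.mem_image.1 hy
      rw [sum_mul_pow_injOn (hαB j) (hαB l) hxy])
    (fun x hx hxy => by
      obtain ⟨j, -, rfl⟩ := Finset.mem_image.1 hx
      exact hne j (sum_mul_pow_injOn (hαB j) hβB hxy)) ((K + 1) * n)
  have hle : ∑ j, X.nrm (e (α j)) ≤ n * ∑ x ∈ Finset.univ.image fun j => e (α j), X.nrm x := by
    refine (Finset.sum_le_card_nsmul _ _ _ fun j _ => Finset.single_le_sum (f := X.nrm)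
      (fun x _ => X.nrm_nonneg x)
      (Finset.mem_image_of_mem (fun j => e (α j)) (Finset.mem_univ j))).trans ?_
    rw [Finset.card_univ, Fintype.card_fin, nsmul_eq_mul]
  have hlt : (K + 1) * ∑ j, X.nrm (e (α j)) < X.nrm (e β) := by
    refine (mul_le_mul_of_nonneg_left hle (by linarith)).trans_lt ?_
    rwa [← mul_assoc]
  have hpos : 0 < X.nrm (e β) := (mul_nonneg (by linarith)
    (Finset.sum_nonneg fun j _ => X.nrm_nonneg _)).trans_lt hlt
  have hr : ‖(((K + 1) / X.nrm (e β) : ℝ) : ℂ)‖ = (K + 1) / X.nrm (e β) := by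
    rw [Complex.norm_real, Real.norm_of_nonneg (by positivity)]
  refine ⟨fun i => B ^ (i : ℕ), X.smul (((K + 1) / X.nrm (e β) : ℝ) : ℂ), ?_, ?_⟩
  · simp_rw [nrm_smul, hr]
    rw [← Finset.mul_sum, div_mul_eq_mul_div, div_lt_one hpos]
    exact hlt
  · rw [nrm_smul, hr, div_mul_cancel₀ _ hpos.ne']
    linarith

/-- (Anisotropic Ornstein non-inequality on the `d`-dimensional quantum torus)
Under the arithmetic conditions (i) and (ii) on the multi-indices `α₁,…,α_n, β`, there is `c > 0`
such that for every skew-symmetric `Θ` with irrational above-diagonal entries in `[0,1]` that are,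
together with `1`, linearly independent over `ℚ`, and every `N ≥ 2`, there exist a complex Hilbert
space, unitaries `U₁,…,U_d` with `U_k U_l = e^{2πiθ_{kl}} U_l U_k`, a unit trace vector `e₀`, and
`f = Σ_γ c_γ U^γ` with `Σ_j τ(|D^{α_j} f|) ≤ 1` and `τ(|D^β f|) ≥ c (log N)^{1/2}`. -/
theorem stmt_16 (d : ℕ) (hd : 2 ≤ d) (n : ℕ) (hn : 0 < n)
    (α : Fin n → Fin d → ℕ) (β : Fin d → ℕ)
    (hΛ : ∃ Λ : Fin d → ℕ, (∀ i, 1 ≤ Λ i) ∧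
      ∀ j : Fin n, ∑ i : Fin d, α j i * Λ i = ∑ i : Fin d, β i * Λ i)
    (hξ : ∃ ξ : Fin d → ℕ, (∀ i, ξ i ≤ 1) ∧
      ¬ (∑ i : Fin d, β i * ξ i ≡ ∑ i : Fin d, α ⟨0, hn⟩ i * ξ i [MOD 2]) ∧
      ∀ j : Fin n, j ≠ ⟨0, hn⟩ →
        (∑ i : Fin d, α j i * ξ i ≡ ∑ i : Fin d, α ⟨0, hn⟩ i * ξ i [MOD 2])) :
    ∃ c > (0 : ℝ),
      ∀ Θ : Matrix (Fin d) (Fin d) ℝ, Matrix.transpose Θ = -Θ →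
        (∀ k l : Fin d, k < l → Θ k l ∈ Set.Icc (0 : ℝ) 1 ∧ Irrational (Θ k l)) →
        (∀ (q₀ : ℚ) (q : Fin d × Fin d → ℚ),
          (q₀ : ℝ) + (∑ p ∈ Finset.univ.filter (fun p : Fin d × Fin d => p.1 < p.2),
              (q p : ℝ) * Θ p.1 p.2) = 0 →
          q₀ = 0 ∧ ∀ p : Fin d × Fin d, p.1 < p.2 → q p = 0) →
        ∀ N : ℕ, 2 ≤ N →
          ∃ S : HilbertSetup, ∃ U : Fin d → unitary (S.H →L[ℂ] S.H),
            (∀ k l : Fin d,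
              (U k : S.H →L[ℂ] S.H) * (U l : S.H →L[ℂ] S.H)
                = Complex.exp (2 * (Real.pi : ℂ) * Complex.I * ((Θ k l : ℝ) : ℂ)) •
                    ((U l : S.H →L[ℂ] S.H) * (U k : S.H →L[ℂ] S.H))) ∧
            ∃ e₀ : S.H, ‖e₀‖ = 1 ∧
              (∀ γ : Fin d → ℤ, γ ≠ 0 → vecState e₀ (qMonoD U γ) = 0) ∧
              ∃ c' : (Fin d → ℤ) →₀ ℂ,
                (∑ j : Fin n, l1Norm e₀ (derivPolyD U c' (α j))) ≤ 1 ∧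
                c * Real.sqrt (Real.log (N : ℝ)) ≤ l1Norm e₀ (derivPolyD U c' β) := by
  obtain ⟨Λ, hΛ1, hΛ⟩ := hΛ
  obtain ⟨ξ, -, hξ0, hξ⟩ := hξ
  have hne : ∀ j, α j ≠ β := fun j hj => by
    by_cases h : j = ⟨0, hn⟩
    · subst h
      exact hξ0 (hj ▸ Nat.ModEq.refl _)
    · exact hξ0 (hj ▸ hξ j h)
  refine ⟨1, one_pos, fun Θ hΘ _ _ N _ => ?_⟩
  obtain ⟨μ, X, hα, hβ⟩ :=
    WaveConfig.exists_sum_nrm_lt α β hne (Real.sqrt_nonneg (Real.log N))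
  obtain ⟨S, T, e₀, he, h0, hmul, hstar, hτ⟩ :=
    exists_twisted_rep (matrixForm Θ) (matrixForm_skew hΘ)
  let U : Fin d → unitary (S.H →L[ℂ] S.H) := fun k =>
    ⟨T (Pi.single k 1), twisted_mem_unitary hΘ h0 hmul hstar _⟩
  have hU : ∀ k, (U k : S.H →L[ℂ] S.H) = T (Pi.single k 1) := fun k => rfl
  obtain ⟨c, hc⟩ := X.exists_tendsto_l1Norm (by omega) hΘ he h0 hmul hstar hτ hU hΛ1 μ
    (∑ i, β i * Λ i)
  have h1 := (tendsto_finsetSum Finset.univ fun j _ => hc (α j) (hΛ j)).eventually_lt_const hα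
  have h2 := (hc β rfl).eventually_const_lt hβ
  obtain ⟨m, hm1, hm2⟩ := (h1.and h2).exists
  refine ⟨S, U, fun k l => ?_, e₀, he, fun γ hγ => ?_, c m, hm1.le, by rw [one_mul]; exact hm2.le⟩
  · rw [hU, hU, twisted_mul_comm hΘ hmul, matrixForm_single]
    rfl
  · obtain ⟨ω, -, hω⟩ := exists_qMonoD_eq hΘ h0 hmul hstar hU γ
    have h3 := hτ γ hγ
    rw [vecState] at h3
    rw [hω, vecState, smul_apply, inner_smul_right, h3, mul_zero]

end
end

section
/- Let θ be an irrational real number. Then the set { n²·θ mod 1 : n ∈ ℕ, n ≥ 1 } is dense in [0,1). In particular, for every ε > 0 there exists a positive integer M₀ such that the distance from M₀²·θ to the nearest integer is less than ε. -/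
/-- A positive power `d²` brings `θ` back near an integer: van der Waerden's theorem for
three-term progressions, applied to the partition of `ℕ` by the position of `n²θ/2` modulo `1`. -/
theorem exists_sq_mul_near_int (θ : ℝ) {ε : ℝ} (hε : 0 < ε) :
    ∃ d : ℕ, 1 ≤ d ∧ ∃ z : ℤ, |(d : ℝ) ^ 2 * θ - z| < ε := by
  obtain ⟨K, hK⟩ := exists_nat_gt (2 / ε)
  have hK0 : (0 : ℝ) < K := lt_trans (by positivity) hK
  have hKε : 2 < ε * K := by rwa [div_lt_iff₀' hε] at hK
  let f : ℕ → ℝ := fun n => Int.fract ((n : ℝ) ^ 2 * (θ / 2))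
  have hf0 : ∀ n, 0 ≤ f n * K := fun n => mul_nonneg (Int.fract_nonneg _) hK0.le
  let C : ℕ → Fin K := fun n => ⟨⌊f n * K⌋₊, by
    rw [Nat.floor_lt (hf0 n)]
    exact mul_lt_of_lt_one_left hK0 (Int.fract_lt_one _)⟩
  have hC : ∀ m n, C m = C n → |f m * K - f n * K| < 1 := by
    intro m n h
    have h' : ⌊f m * K⌋₊ = ⌊f n * K⌋₊ := congrArg Fin.val h
    have h1 := Nat.floor_le (hf0 m)
    have h2 := Nat.lt_floor_add_one (f m * K)
    have h3 := Nat.floor_le (hf0 n)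
    have h4 := Nat.lt_floor_add_one (f n * K)
    rw [h'] at h1 h2
    rw [abs_lt]
    constructor <;> linarith
  obtain ⟨d, hd, b, c, h⟩ := Combinatorics.exists_mono_homothetic_copy ({0, 1, 2} : Finset ℕ) C
  have h0 := h 0 (by simp)
  have h1 := h 1 (by simp)
  have h2 := h 2 (by simp)
  have e0 := abs_lt.1 (hC _ _ (h0.trans h1.symm))
  have e2 := abs_lt.1 (hC _ _ (h2.trans h1.symm))
  let F : ℕ → ℤ := fun n => ⌊(n : ℝ) ^ 2 * (θ / 2)⌋
  have hF : ∀ n, f n = (n : ℝ) ^ 2 * (θ / 2) - F n := fun n => rfl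
  refine ⟨d, hd, F (d • 2 + b) - 2 * F (d • 1 + b) + F (d • 0 + b), ?_⟩
  have key : (d : ℝ) ^ 2 * θ
      - ((F (d • 2 + b) - 2 * F (d • 1 + b) + F (d • 0 + b) : ℤ) : ℝ)
      = f (d • 2 + b) - 2 * f (d • 1 + b) + f (d • 0 + b) := by
    rw [hF, hF, hF]
    push_cast [smul_eq_mul]
    ring
  rw [key, abs_lt]
  constructor <;> nlinarith

/-- Integer multiples of an irrational number, modulo `1`, meet every open interval. -/
theorem Irrational.exists_int_mul_sub_mem_Ioo {α : ℝ} (hα : Irrational α) {u v : ℝ} (huv : u < v) :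
    ∃ r z : ℤ, r * α - z ∈ Set.Ioo u v := by
  have hdense : Dense (AddSubgroup.closure {α, 1} : Set ℝ) :=
    dense_addSubgroupClosure_pair_iff.2 (by rwa [div_one])
  obtain ⟨y, hmem, hy⟩ := hdense.exists_mem_open isOpen_Ioo (Set.nonempty_Ioo.2 huv)
  obtain ⟨a, b, rfl⟩ := AddSubgroup.mem_closure_pair.1 hmem
  exact ⟨a, -b, by simpa using hy⟩

/-- The numbers `n²θ`, modulo `1`, meet every open interval. -/
theorem Irrational.exists_int_sq_mul_sub_mem_Ioo {θ : ℝ} (hθ : Irrational θ) {u v : ℝ}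
    (huv : u < v) : ∃ n z : ℤ, (n : ℝ) ^ 2 * θ - z ∈ Set.Ioo u v := by
  obtain ⟨δ, rfl⟩ : ∃ δ, v = u + δ := ⟨v - u, by ring⟩
  have hδ : 0 < δ := by linarith
  obtain ⟨N, hN⟩ := exists_nat_gt (8 / δ)
  rw [div_lt_iff₀ hδ] at hN
  obtain ⟨s, hs, w, hw⟩ := exists_sq_mul_near_int θ
    (show 0 < δ / (8 * (2 * N + 1)) by positivity)
  rw [lt_div_iff₀ (by positivity)] at hw
  have hsθ : Irrational (((2 * s : ℕ) : ℝ) * θ) := hθ.natCast_mul (by omega)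
  obtain ⟨r, k, hβ⟩ := hsθ.exists_int_mul_sub_mem_Ioo (show δ / 4 < δ / 2 by linarith)
  set β : ℝ := r * (((2 * s : ℕ) : ℝ) * θ) - k with hβ_def
  set η : ℝ := (s : ℝ) ^ 2 * θ - w with hη_def
  let g : ℕ → ℝ := fun m => (r : ℝ) ^ 2 * θ + m * β + (m : ℝ) ^ 2 * η
  obtain ⟨l, hl⟩ : ∃ l : ℤ, l = ⌊g 0 - u⌋ + 1 := ⟨_, rfl⟩
  have hl1 : g 0 < u + l := by
    have := Int.lt_floor_add_one (g 0 - u)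
    rw [hl]; push_cast; linarith
  have hl2 : u + l ≤ g 0 + 1 := by
    have := Int.floor_le (g 0 - u)
    rw [hl]; push_cast; linarith
  have hη : |η| * (2 * N + 1) < δ / 8 := by linarith
  have hgN : u + l < g N := by
    have h1 : -(|η| * N) ≤ N * η := by nlinarith [neg_abs_le η, Nat.cast_nonneg (α := ℝ) N]
    have h2 : |η| * N ≤ |η| * (2 * N + 1) := by gcongr; linarith [Nat.cast_nonneg (α := ℝ) N]
    have h3 : δ / 8 ≤ β + N * η := by linarith [hβ.1]
    have h4 : N * (δ / 8) ≤ N * (β + N * η) := by gcongr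
    have h5 : g N = g 0 + N * (β + N * η) := by simp only [g]; push_cast; ring
    linarith
  classical
  have hex : ∃ m, u + l < g m := ⟨N, hgN⟩
  obtain ⟨m, hm⟩ : ∃ m, Nat.find hex = m + 1 :=
    Nat.exists_eq_succ_of_ne_zero fun h => by
      have := Nat.find_spec hex
      rw [h] at this
      linarith
  have hm_spec : u + l < g (m + 1) := hm ▸ Nat.find_spec hex
  have hm_prev : g m ≤ u + l := not_lt.1 (Nat.find_min hex (by omega))
  have hmN : m + 1 ≤ N := hm ▸ Nat.find_min' hex hgN
  have hmN' : (m : ℝ) + 1 ≤ N := by exact_mod_cast hmN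
  have hstep : g (m + 1) - g m < δ := by
    have h1 : (2 * m + 1) * η ≤ (2 * m + 1) * |η| := by gcongr; exact le_abs_self η
    have h2 : |η| * (2 * m + 1) ≤ |η| * (2 * N + 1) := by gcongr; linarith
    have h3 : g (m + 1) - g m = β + (2 * m + 1) * η := by simp only [g]; push_cast; ring
    linarith [hβ.2]
  refine ⟨r + s * (m + 1), l + (m + 1) * k + (m + 1) ^ 2 * w, ?_⟩
  have hg : ((r + s * (m + 1) : ℤ) : ℝ) ^ 2 * θ - ((l + (m + 1) * k + (m + 1) ^ 2 * w : ℤ) : ℝ)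
      = g (m + 1) - l := by
    simp only [g, hβ_def, hη_def]; push_cast; ring
  rw [hg]
  constructor <;> linarith

/-- For an irrational real `θ`, the fractional parts `{n² θ}` (`n ≥ 1`) are
dense in `[0,1)`; in particular, for every `ε > 0` there is a positive integer `M₀` whose
square multiple `M₀² θ` is within `ε` of an integer. -/
theorem stmt_19 (θ : ℝ) (hθ : Irrational θ) :
    (∀ x ∈ Set.Ico (0 : ℝ) 1,
      x ∈ closure {y : ℝ | ∃ n : ℕ, 1 ≤ n ∧ y = Int.fract ((n : ℝ) ^ 2 * θ)}) ∧
    (∀ ε > (0 : ℝ), ∃ M₀ : ℕ, 1 ≤ M₀ ∧ ∃ z : ℤ, |(M₀ : ℝ) ^ 2 * θ - (z : ℝ)| < ε) := by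
  refine ⟨fun x hx => Metric.mem_closure_iff.2 fun ε hε => ?_,
    fun ε hε => exists_sq_mul_near_int θ hε⟩
  obtain ⟨n, z, hn1, hn2⟩ := hθ.exists_int_sq_mul_sub_mem_Ioo
    (show x < min (x + ε) 1 from lt_min (by linarith) hx.2)
  obtain ⟨hnε, hn_one⟩ := lt_min_iff.1 hn2
  have hpos : 0 < (n : ℝ) ^ 2 * θ - z := hx.1.trans_lt hn1
  have hfract : Int.fract ((n : ℝ) ^ 2 * θ) = (n : ℝ) ^ 2 * θ - z :=
    Int.fract_eq_iff.2 ⟨hpos.le, hn_one, z, by ring⟩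
  refine ⟨_, ⟨n.natAbs, ?_, rfl⟩, ?_⟩
  · rw [Nat.one_le_iff_ne_zero, Int.natAbs_ne_zero]
    rintro rfl
    rw [← hfract] at hpos
    simp at hpos
  · rw [Nat.cast_natAbs, Int.cast_abs, sq_abs, hfract, Real.dist_eq, abs_lt]
    constructor <;> linarith
end
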